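/- There exists a fully divergent, infinite in limit basic sequence Q such that the set of real numbers that are Q-normal of every order, AP Q-abnormal of type I, and not AP Q-normal of type II has full Hausdorff dimension: dim_H(N(Q) ∩ N^{I}_{Ab}(Q) \ N^{II}(Q)) = 1. -/

import Mathlib

open Filter MeasureTheory Finset
open scoped Topology Classical

/-- A basic sequence: a sequence of integers, each at least `2`. -/
def IsBasic (q : ℕ → ℕ) : Prop := ∀ n, 2 ≤ q n

/-- The product `q_0 q_1 ⋯ q_{n-1}` of the first `n` terms of the basic sequence. -/
def qprod (q : ℕ → ℕ) (n : ℕ) : ℝ := ∏ i ∈ Finset.range n, (q i : ℝ)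

/-- `T_{Q,n}(x) = (q_0 q_1 ⋯ q_{n-1}) x mod 1`. -/
noncomputable def TQ (q : ℕ → ℕ) (n : ℕ) (x : ℝ) : ℝ := Int.fract (qprod q n * x)

/-- The `n`-th digit `E_n` of the `Q`-Cantor series expansion of `x`
(digit positions are indexed by `0, 1, 2, …`). -/
noncomputable def qdigit (q : ℕ → ℕ) (x : ℝ) (n : ℕ) : ℕ := ⌊(q n : ℝ) * TQ q n x⌋₊

/-- `N_n^Q(B,x)`: the number of occurrences of the block `B` starting among the first `n`
digit positions of the `Q`-Cantor series expansion of `x`. -/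
noncomputable def blockCount (q : ℕ → ℕ) (x : ℝ) {k : ℕ} (B : Fin k → ℕ) (n : ℕ) : ℕ :=
  ((Finset.range n).filter fun i => ∀ j : Fin k, qdigit q x (i + (j : ℕ)) = B j).card

/-- `Q_n^{(k)} = ∑_{j<n} 1/(q_j q_{j+1} ⋯ q_{j+k-1})`. -/
noncomputable def Qsum (q : ℕ → ℕ) (k n : ℕ) : ℝ :=
  ∑ j ∈ Finset.range n, (∏ i ∈ Finset.range k, (q (j + i) : ℝ))⁻¹

/-- `x` is `Q`-normal of order `k`: every block of length `k` occurs with the expected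
asymptotic frequency. -/
def QNormalOfOrder (q : ℕ → ℕ) (k : ℕ) (x : ℝ) : Prop :=
  ∀ B : Fin k → ℕ,
    Tendsto (fun n => (blockCount q x B n : ℝ) / Qsum q k n) atTop (𝓝 1)

/-- `x ∈ N(Q)`: `x` is `Q`-normal of every order `k ≥ 1`. -/
def QNormal (q : ℕ → ℕ) (x : ℝ) : Prop := ∀ k, 1 ≤ k → QNormalOfOrder q k x

/-- `Q` is fully divergent: `Q_n^{(k)} → ∞` for every `k ≥ 1`. -/
def FullyDivergent (q : ℕ → ℕ) : Prop :=
  ∀ k, 1 ≤ k → Tendsto (fun n => Qsum q k n) atTop atTop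

/-- `Q` is infinite in limit: `q_n → ∞`. -/
def InfiniteInLimit (q : ℕ → ℕ) : Prop := Tendsto q atTop atTop

/-- `N_{n,m,r}^Q(B,x)`: occurrences of the block `B` (of length `m`) starting at
positions `i < n` with `i ≡ r (mod m)`. -/
noncomputable def apCount (q : ℕ → ℕ) (x : ℝ) (m r : ℕ) (B : Fin m → ℕ) (n : ℕ) : ℕ :=
  ((Finset.range n).filter fun i =>
    i % m = r ∧ ∀ j : Fin m, qdigit q x (i + (j : ℕ)) = B j).card

/-- `Q_n^{(m,r)} = ∑_{j=0}^{⌊(n-r)/m⌋} 1/(q_{mj+r} q_{mj+r+1} ⋯ q_{mj+r+m-1})`. -/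
noncomputable def apQsum (q : ℕ → ℕ) (m r n : ℕ) : ℝ :=
  ∑ j ∈ Finset.range ((n - r) / m + 1),
    (∏ i ∈ Finset.range m, (q (m * j + r + i) : ℝ))⁻¹

/-- `x ∈ N^{I}_{m,r}(Q)`. -/
def MemNAPI (q : ℕ → ℕ) (m r : ℕ) (x : ℝ) : Prop :=
  ∀ B : Fin m → ℕ,
    Tendsto (fun n => (apCount q x m r B n : ℝ) / apQsum q m r n) atTop (𝓝 1)

/-- `x ∈ N^{I}_{Ab}(Q)`: `x` is AP `Q`-abnormal of type I. -/
def APAbnormalI (q : ℕ → ℕ) (x : ℝ) : Prop :=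
  ∀ m, 2 ≤ m → ∀ r, r < m → ¬ MemNAPI q m r x

/-- `x ∈ RN^{I}(Q)`. -/
def MemRNI (q : ℕ → ℕ) (x : ℝ) : Prop :=
  ∀ m, 1 ≤ m → ∀ r, r < m → ∀ B₁ B₂ : Fin m → ℕ,
    Tendsto (fun n => (apCount q x m r B₁ n : ℝ) / (apCount q x m r B₂ n : ℝ))
      atTop (𝓝 1)

/-- `Λ_{m,r}(Q) = (q_{mt+r})_t`. -/
def lamQ (q : ℕ → ℕ) (m r : ℕ) : ℕ → ℕ := fun t => q (m * t + r)

/-- `Υ_{Q,m,r}(x)`: the real number whose `Λ_{m,r}(Q)`-Cantor series digits are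
`(E_{mt+r})_t`, where `(E_n)` are the `Q`-Cantor series digits of `x`. -/
noncomputable def Ups (q : ℕ → ℕ) (m r : ℕ) (x : ℝ) : ℝ :=
  ∑' t : ℕ, (qdigit q x (m * t + r) : ℝ) / ∏ i ∈ Finset.range (t + 1), (lamQ q m r i : ℝ)

/-- `x ∈ N^{II}_{k,m,r}(Q) = Υ_{Q,m,r}^{-1}(N_k(Λ_{m,r}(Q)))`. -/
def MemNAPII (q : ℕ → ℕ) (k m r : ℕ) (x : ℝ) : Prop :=
  QNormalOfOrder (lamQ q m r) k (Ups q m r x)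

/-- `x ∈ N^{II}(Q)`: `x` is AP `Q`-normal of type II. -/
def APNormalII (q : ℕ → ℕ) (x : ℝ) : Prop :=
  ∀ k, 1 ≤ k → ∀ m, 1 ≤ m → ∀ r, r < m → MemNAPII q k m r x

/-- `x ∈ RN^{II}(Q)`: for all `k, m, r` the counts in `Υ_{Q,m,r}(x)` of any two blocks of
length `k` with respect to `Λ_{m,r}(Q)` have ratio tending to `1`. -/
def MemRNII (q : ℕ → ℕ) (x : ℝ) : Prop :=
  ∀ k, 1 ≤ k → ∀ m, 1 ≤ m → ∀ r, r < m → ∀ B₁ B₂ : Fin k → ℕ,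
    Tendsto (fun n =>
      (blockCount (lamQ q m r) (Ups q m r x) B₁ n : ℝ) /
      (blockCount (lamQ q m r) (Ups q m r x) B₂ n : ℝ)) atTop (𝓝 1)

/-- `S` (a set of positive integers) is almost closed under addition: for every `k ∈ S`,
the set `{x ∉ S : x + k ∈ S}` has asymptotic density `0`. -/
def AlmostClosed (S : Set ℕ) : Prop :=
  ∀ k ∈ S, Tendsto
    (fun t : ℕ => (((Finset.Icc 1 t).filter fun x => x ∉ S ∧ x + k ∈ S).card : ℝ) / t)
    atTop (𝓝 0)

/-- The sequence `u` of reals is uniformly distributed mod 1. -/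
def UDMod1 (u : ℕ → ℝ) : Prop :=
  ∀ a b : ℝ, 0 ≤ a → a < b → b ≤ 1 →
    Tendsto (fun N => (((Finset.range N).filter fun n => u n ∈ Set.Ico a b).card : ℝ) / N)
      atTop (𝓝 (b - a))

/-- `x ∈ DN(Q)`: `x` is `Q`-distribution normal. -/
def DistNormal (q : ℕ → ℕ) (x : ℝ) : Prop := UDMod1 fun n => TQ q n x

/-- `x ∈ DN_{Ab}(Q)`: `x` is AP `Q`-distribution abnormal. -/
def APDistAbnormal (q : ℕ → ℕ) (x : ℝ) : Prop :=
  ∀ m, 2 ≤ m → ∀ r, r < m → ¬ UDMod1 fun n => TQ q (m * n + r) x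

/-- `y ∈ D_{(x_n)}(Q)`: for every `ξ ∈ (0,1)`, the proportion of `n ≤ N` with
`fract (T_{Q,n}(y) - x_n) < ξ` tends to `1`. -/
def MemD (q : ℕ → ℕ) (xs : ℕ → ℝ) (y : ℝ) : Prop :=
  ∀ ξ : ℝ, 0 < ξ → ξ < 1 →
    Tendsto (fun N =>
      (((Finset.range N).filter fun n => Int.fract (TQ q n y - xs n) < ξ).card : ℝ) / N)
      atTop (𝓝 1)

/-- A computable real number. -/
def ComputableReal (x : ℝ) : Prop :=
  ∃ f : ℕ → ℕ, Computable f ∧ ∀ n : ℕ, 0 < n → (f n : ℝ) / n ≤ x ∧ x ≤ ((f n : ℝ) + 1) / n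

/-- The indicator function `1_{ℕ∖S}` of the complement of `S`, with values in `ℤ`. -/
noncomputable def indZ (S : Set ℕ) (i : ℕ) : ℤ := if i ∈ S then 0 else 1

/-- The indicator function `1_{ℕ∖S}` of the complement of `S`, with values in `ℝ`. -/
noncomputable def indR (S : Set ℕ) (i : ℕ) : ℝ := if i ∈ S then 0 else 1

/-- The coefficients `c_{t,i}`: `c_{t,1} = t (1+ε)^{1_{ℕ∖S}(1)}` and
`c_{t,i} = (1+ε)^{1_{ℕ∖S}(i) - 1_{ℕ∖S}(i-1)}` for `i ≥ 2`. -/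
noncomputable def coeff (S : Set ℕ) (ε : ℝ) (t i : ℕ) : ℝ :=
  if i = 1 then (t : ℝ) * (1 + ε) ^ indZ S 1
  else (1 + ε) ^ (indZ S i - indZ S (i - 1))

/-- `N_k(b)`: the set of real numbers normal of order `k` in base `b`. -/
def BaseNormalOfOrder (b k : ℕ) : Set ℝ :=
  {x | ∀ B : Fin k → ℕ, (∀ j, B j < b) →
    Tendsto (fun n => (blockCount (fun _ => b) x B n : ℝ) / n) atTop
      (𝓝 (((b : ℝ) ^ k)⁻¹))}


/-! ### Cantor series with prescribed digits -/

/-- The real number with `Q`-Cantor series digits `e`. -/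
noncomputable def cantorValue (q e : ℕ → ℕ) : ℝ :=
  ∑' t : ℕ, (e t : ℝ) / ∏ i ∈ Finset.range (t + 1), (q i : ℝ)

lemma qprod_pos {q : ℕ → ℕ} (hq : ∀ n, 1 ≤ q n) (n : ℕ) : 0 < qprod q n :=
  Finset.prod_pos fun i _ => by exact_mod_cast hq i

lemma qprod_succ (q : ℕ → ℕ) (n : ℕ) : qprod q (n + 1) = qprod q n * q n :=
  Finset.prod_range_succ _ _

lemma TQ_nonneg (q : ℕ → ℕ) (n : ℕ) (x : ℝ) : 0 ≤ TQ q n x := Int.fract_nonneg _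

lemma TQ_lt_one (q : ℕ → ℕ) (n : ℕ) (x : ℝ) : TQ q n x < 1 := Int.fract_lt_one _

lemma fract_natCast_mul_fract (a : ℕ) (x : ℝ) :
    Int.fract ((a : ℝ) * Int.fract x) = Int.fract ((a : ℝ) * x) := by
  refine Int.fract_eq_fract.2 ⟨-(a * ⌊x⌋), ?_⟩
  have := Int.floor_add_fract x
  push_cast
  linear_combination (a : ℝ) * this

lemma TQ_succ (q : ℕ → ℕ) (n : ℕ) (x : ℝ) :
    TQ q (n + 1) x = Int.fract ((q n : ℝ) * TQ q n x) := by
  rw [TQ, TQ, fract_natCast_mul_fract, qprod_succ]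
  ring_nf

lemma qdigit_add_TQ_succ (q : ℕ → ℕ) (n : ℕ) (x : ℝ) :
    (qdigit q x n : ℝ) + TQ q (n + 1) x = q n * TQ q n x := by
  have h : (0 : ℝ) ≤ (q n : ℝ) * TQ q n x := mul_nonneg (Nat.cast_nonneg _) (TQ_nonneg _ _ _)
  rw [TQ_succ, qdigit, natCast_floor_eq_intCast_floor h, Int.floor_add_fract]

lemma qdigit_lt {q : ℕ → ℕ} (hq : ∀ n, 1 ≤ q n) (x : ℝ) (n : ℕ) : qdigit q x n < q n := by
  have hpos : (0 : ℝ) < q n := by exact_mod_cast hq n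
  rw [qdigit, Nat.floor_lt (mul_nonneg hpos.le (TQ_nonneg _ _ _))]
  nlinarith [TQ_lt_one q n x]

lemma qprod_mul_sub_of_qdigit_eq {q : ℕ → ℕ} {x y : ℝ} (hx : x ∈ Set.Ico (0 : ℝ) 1)
    (hy : y ∈ Set.Ico (0 : ℝ) 1) {n : ℕ} (h : ∀ i < n, qdigit q x i = qdigit q y i) :
    qprod q n * (x - y) = TQ q n x - TQ q n y := by
  induction n with
  | zero => simp [TQ, qprod, Int.fract_eq_self.2 hx, Int.fract_eq_self.2 hy]
  | succ n ih =>
    have h1 := ih fun i hi => h i (hi.trans n.lt_succ_self)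
    have h2 := qdigit_add_TQ_succ q n x
    have h3 := qdigit_add_TQ_succ q n y
    rw [h n n.lt_succ_self] at h2
    rw [qprod_succ]
    linear_combination (q n : ℝ) * h1 - h2 + h3

lemma sum_digits_le {q e : ℕ → ℕ} (h : ∀ n, e n + 1 ≤ q n) (N : ℕ) :
    ∑ t ∈ Finset.range N, (e t : ℝ) / qprod q (t + 1) ≤ 1 - (qprod q N)⁻¹ := by
  have hq : ∀ n, 1 ≤ q n := fun n => le_trans (Nat.le_add_left _ _) (h n)
  induction N with
  | zero => simp [qprod]
  | succ N ih =>
    rw [Finset.sum_range_succ]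
    have h1 : (e N : ℝ) + 1 ≤ q N := by exact_mod_cast h N
    have hp := qprod_pos hq N
    have hqN : (0 : ℝ) < q N := by exact_mod_cast hq N
    have h2 : (e N : ℝ) / qprod q (N + 1) ≤ (qprod q N)⁻¹ - (qprod q (N + 1))⁻¹ := by
      rw [qprod_succ]
      have h3 : (qprod q N)⁻¹ - (qprod q N * q N)⁻¹ = ((q N : ℝ) - 1) / (qprod q N * q N) := by
        field_simp
      rw [h3]
      gcongr
      linarith
    linarith

lemma digit_term_nonneg {q e : ℕ → ℕ} (t : ℕ) : 0 ≤ (e t : ℝ) / qprod q (t + 1) :=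
  div_nonneg (Nat.cast_nonneg _) (Finset.prod_nonneg fun _ _ => Nat.cast_nonneg _)

lemma sum_digits_le_one {q e : ℕ → ℕ} (h : ∀ n, e n + 1 ≤ q n) (N : ℕ) :
    ∑ t ∈ Finset.range N, (e t : ℝ) / qprod q (t + 1) ≤ 1 := by
  have hq : ∀ n, 1 ≤ q n := fun n => le_trans (Nat.le_add_left _ _) (h n)
  have := sum_digits_le h N
  have := inv_pos.2 (qprod_pos hq N)
  linarith

lemma summable_digits {q e : ℕ → ℕ} (h : ∀ n, e n + 1 ≤ q n) :
    Summable fun t => (e t : ℝ) / qprod q (t + 1) :=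
  summable_of_sum_range_le digit_term_nonneg (sum_digits_le_one h)

lemma cantorValue_nonneg (q e : ℕ → ℕ) : 0 ≤ cantorValue q e :=
  tsum_nonneg digit_term_nonneg

lemma cantorValue_le_one {q e : ℕ → ℕ} (h : ∀ n, e n + 1 ≤ q n) : cantorValue q e ≤ 1 :=
  Real.tsum_le_of_sum_range_le digit_term_nonneg (sum_digits_le_one h)

lemma cantorValue_eq {q e : ℕ → ℕ} (h : ∀ n, e n + 1 ≤ q n) :
    q 0 * cantorValue q e =
      e 0 + cantorValue (fun i => q (i + 1)) (fun i => e (i + 1)) := by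
  have hq : (q 0 : ℝ) ≠ 0 := by have := h 0; exact_mod_cast (by omega : q 0 ≠ 0)
  have h1 : cantorValue q e = (e 0 : ℝ) / q 0 +
      cantorValue (fun i => q (i + 1)) (fun i => e (i + 1)) / q 0 := by
    refine (summable_digits h).tsum_eq_zero_add.trans ?_
    rw [cantorValue, ← tsum_div_const]
    congr 1
    · simp [qprod]
    · refine tsum_congr fun t => ?_
      rw [qprod, Finset.prod_range_succ', div_div]
  rw [h1]
  field_simp

lemma cantorValue_le {q e : ℕ → ℕ} (h : ∀ n, e n + 2 ≤ q n) :
    cantorValue q e ≤ 1 - (q 0 : ℝ)⁻¹ := by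
  have h' : ∀ n, e n + 1 ≤ q n := fun n => (Nat.le_succ _).trans (h n)
  have h1 := cantorValue_eq h'
  have h2 := cantorValue_le_one (q := fun i => q (i + 1)) (e := fun i => e (i + 1))
    fun n => h' (n + 1)
  have h0 : (e 0 : ℝ) + 2 ≤ q 0 := by exact_mod_cast h 0
  have hq : (0 : ℝ) < q 0 := by
    have := Nat.cast_nonneg (α := ℝ) (e 0)
    linarith
  have h3 : (q 0 : ℝ) * cantorValue q e ≤ q 0 * (1 - (q 0 : ℝ)⁻¹) := by
    rw [mul_sub, mul_inv_cancel₀ hq.ne']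
    linarith
  exact le_of_mul_le_mul_left h3 hq

lemma cantorValue_lt_one {q e : ℕ → ℕ} (h : ∀ n, e n + 2 ≤ q n) : cantorValue q e < 1 := by
  have h1 := cantorValue_le h
  have : (0 : ℝ) < (q 0 : ℝ)⁻¹ := inv_pos.2 (by have := h 0; exact_mod_cast (by omega : 0 < q 0))
  linarith

lemma cantorValue_mem {q e : ℕ → ℕ} (h : ∀ n, e n + 2 ≤ q n) :
    cantorValue q e ∈ Set.Ico (0 : ℝ) 1 :=
  ⟨cantorValue_nonneg _ _, cantorValue_lt_one h⟩

lemma TQ_cantorValue {q e : ℕ → ℕ} (h : ∀ n, e n + 2 ≤ q n) (n : ℕ) :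
    TQ q n (cantorValue q e) = cantorValue (fun i => q (i + n)) (fun i => e (i + n)) := by
  induction n with
  | zero => simp [TQ, qprod, Int.fract_eq_self.2 (cantorValue_mem h)]
  | succ n ih =>
    have h1 := cantorValue_eq (q := fun i => q (i + n)) (e := fun i => e (i + n))
      fun m => (Nat.le_succ _).trans (h _)
    simp only [zero_add] at h1
    have h2 := cantorValue_mem (q := fun i => q (i + 1 + n)) (e := fun i => e (i + 1 + n))
      fun m => h _
    rw [TQ_succ, ih, h1, Int.fract_natCast_add, Int.fract_eq_self.2 h2]
    simp only [add_assoc, add_comm 1 n]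

lemma qdigit_cantorValue {q e : ℕ → ℕ} (h : ∀ n, e n + 2 ≤ q n) (n : ℕ) :
    qdigit q (cantorValue q e) n = e n := by
  have h1 := qdigit_add_TQ_succ q n (cantorValue q e)
  have h2 := cantorValue_eq (q := fun i => q (i + n)) (e := fun i => e (i + n))
    fun m => (Nat.le_succ _).trans (h _)
  have h3 : cantorValue (fun i => q (i + 1 + n)) (fun i => e (i + 1 + n)) =
      TQ q (n + 1) (cantorValue q e) := by
    rw [TQ_cantorValue h]
    simp only [add_assoc, add_comm 1 n]
  simp only [zero_add] at h2
  rw [TQ_cantorValue h n, h2, h3] at h1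
  exact_mod_cast add_right_cancel h1

/-- Digit sequences staying below `q n - 1` that first differ at position `n` have values at
distance at least `1 / (q 0 ⋯ q (n + 1))`. -/
lemma inv_qprod_le_abs_sub {q e e' : ℕ → ℕ} (h : ∀ n, e n + 2 ≤ q n) (h' : ∀ n, e' n + 2 ≤ q n)
    {n : ℕ} (heq : ∀ i < n, e i = e' i) (hne : e n ≠ e' n) :
    (qprod q (n + 2))⁻¹ ≤ |cantorValue q e - cantorValue q e'| := by
  have hq : ∀ n, 1 ≤ q n := fun n => le_trans (by omega) (h n)
  have h1 := qprod_mul_sub_of_qdigit_eq (q := q) (n := n) (cantorValue_mem h) (cantorValue_mem h')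
    (fun i hi => by rw [qdigit_cantorValue h, qdigit_cantorValue h', heq i hi])
  have h2 := qdigit_add_TQ_succ q n (cantorValue q e)
  have h3 := qdigit_add_TQ_succ q n (cantorValue q e')
  have bound : ∀ {a : ℕ → ℕ}, (∀ n, a n + 2 ≤ q n) →
      TQ q (n + 1) (cantorValue q a) ≤ 1 - (q (n + 1) : ℝ)⁻¹ := by
    intro a ha
    rw [TQ_cantorValue ha]
    simpa using cantorValue_le (q := fun i => q (i + (n + 1))) (e := fun i => a (i + (n + 1)))
      fun m => ha _
  have b1 := bound h
  have b2 := bound h'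
  have b3 := TQ_nonneg q (n + 1) (cantorValue q e)
  have b4 := TQ_nonneg q (n + 1) (cantorValue q e')
  rw [qdigit_cantorValue h] at h2
  rw [qdigit_cantorValue h'] at h3
  have h4 : qprod q (n + 1) * (cantorValue q e - cantorValue q e') =
      ((e n : ℝ) - e' n) +
        (TQ q (n + 1) (cantorValue q e) - TQ q (n + 1) (cantorValue q e')) := by
    rw [qprod_succ]
    linear_combination (q n : ℝ) * h1 - h2 + h3
  have hp := qprod_pos hq (n + 1)
  have hqn : (0 : ℝ) < q (n + 1) := by exact_mod_cast hq (n + 1)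
  have h5 : (q (n + 1) : ℝ)⁻¹ ≤ |qprod q (n + 1) * (cantorValue q e - cantorValue q e')| := by
    rw [h4, le_abs]
    rcases lt_or_gt_of_ne hne with hlt | hlt
    · right
      have : (e n : ℝ) + 1 ≤ e' n := by exact_mod_cast hlt
      linarith
    · left
      have : (e' n : ℝ) + 1 ≤ e n := by exact_mod_cast hlt
      linarith
  rw [abs_mul, abs_of_pos hp] at h5
  rw [qprod_succ, mul_inv, ← div_eq_inv_mul, div_le_iff₀' hp]
  exact h5

lemma abs_sub_le_inv_qprod {q : ℕ → ℕ} (hq : ∀ n, 1 ≤ q n) {x y : ℝ}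
    (hx : x ∈ Set.Ico (0 : ℝ) 1) (hy : y ∈ Set.Ico (0 : ℝ) 1) {n : ℕ}
    (h : ∀ i < n, qdigit q x i = qdigit q y i) : |x - y| ≤ (qprod q n)⁻¹ := by
  have h1 := qprod_mul_sub_of_qdigit_eq hx hy h
  have hp := qprod_pos hq n
  have h2 : |qprod q n * (x - y)| ≤ 1 := by
    rw [h1, abs_le]
    constructor <;> linarith [TQ_nonneg q n x, TQ_nonneg q n y, TQ_lt_one q n x, TQ_lt_one q n y]
  rw [abs_mul, abs_of_pos hp] at h2
  rw [← one_div, le_div_iff₀' hp]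
  exact h2

/-! ### A lower bound for the Hausdorff dimension -/

lemma two_pow_le_qprod {q : ℕ → ℕ} (hq : ∀ n, 2 ≤ q n) (n : ℕ) : (2 : ℝ) ^ n ≤ qprod q n := by
  induction n with
  | zero => simp [qprod]
  | succ n ih =>
    rw [qprod_succ, pow_succ]
    have : (2 : ℝ) ≤ q n := by exact_mod_cast hq n
    exact mul_le_mul ih this (by norm_num) (le_trans (by positivity) ih)

/-- The map sending `y` to the number whose `Q`-digits are the `C`-digits of `y` shifted by `low`
is expanding up to an exponent `s < 1`. -/
lemma abs_sub_le_rpow_abs_sub {q c low : ℕ → ℕ} (hc : ∀ n, 1 ≤ c n)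
    (hq : ∀ n, low n + c n + 1 ≤ q n) {s C : ℝ} (hs : 0 < s)
    (growth : ∀ n, qprod q (n + 2) ^ s ≤ C * qprod c n) {x y : ℝ} (hx : x ∈ Set.Ico (0 : ℝ) 1)
    (hy : y ∈ Set.Ico (0 : ℝ) 1) :
    |x - y| ≤ C * |cantorValue q (fun n => low n + qdigit c x n) -
      cantorValue q (fun n => low n + qdigit c y n)| ^ s := by
  have hq2 : ∀ n, 2 ≤ q n := fun n => by have := hq n; have := hc n; omega
  have hq1 : ∀ n, 1 ≤ q n := fun n => (Nat.le_succ 1).trans (hq2 n)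
  have hdig : ∀ (z : ℝ) (n : ℕ), low n + qdigit c z n + 2 ≤ q n := fun z n => by
    have := qdigit_lt hc z n
    have := hq n
    omega
  have key : ∀ n, (qprod c n)⁻¹ ≤ C * ((qprod q (n + 2))⁻¹) ^ s := by
    intro n
    have h1 := growth n
    have hp := qprod_pos hq1 (n + 2)
    have hps : 0 < qprod q (n + 2) ^ s := Real.rpow_pos_of_pos hp s
    rw [Real.inv_rpow hp.le, ← div_eq_mul_inv, le_div_iff₀ hps, inv_mul_eq_div,
      div_le_iff₀ (qprod_pos hc n)]
    exact h1
  by_cases hex : ∃ n, qdigit c x n ≠ qdigit c y n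
  · have hne := Nat.find_spec hex
    have hmin : ∀ i < Nat.find hex, qdigit c x i = qdigit c y i := fun i hi =>
      not_not.1 (Nat.find_min hex hi)
    generalize Nat.find hex = n at hne hmin
    have hC : 0 ≤ C := by
      have h1 : 0 < C * qprod c n :=
        (Real.rpow_pos_of_pos (qprod_pos hq1 (n + 2)) s).trans_le (growth n)
      exact (pos_of_mul_pos_left h1 (qprod_pos hc n).le).le
    have h1 := inv_qprod_le_abs_sub (hdig x) (hdig y) (n := n)
      (fun i hi => by rw [hmin i hi]) (fun h => hne (by omega))
    refine (abs_sub_le_inv_qprod hc hx hy hmin).trans ((key n).trans ?_)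
    have h2 := qprod_pos hq1 (n + 2)
    gcongr
  · push Not at hex
    rcases eq_or_ne x y with rfl | hxy
    · simp [Real.zero_rpow hs.ne']
    · exfalso
      have hd : 0 < |x - y| := abs_pos.2 (sub_ne_zero.2 hxy)
      have h2s : (1 : ℝ) < 2 ^ s := Real.one_lt_rpow (by norm_num) hs
      obtain ⟨n, hn⟩ := pow_unbounded_of_one_lt (C / |x - y|) h2s
      have h1 := abs_sub_le_inv_qprod hc hx hy (n := n) fun i _ => hex i
      have h2 : |x - y| * qprod c n ≤ 1 := by
        rwa [← le_div_iff₀ (qprod_pos hc n), one_div]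
      have h3 : ((2 : ℝ) ^ s) ^ n ≤ C * qprod c n := by
        refine le_trans ?_ (growth n)
        rw [← Real.rpow_natCast, ← Real.rpow_mul (by norm_num), mul_comm,
          Real.rpow_mul (by norm_num), Real.rpow_natCast]
        refine Real.rpow_le_rpow (by positivity) ?_ hs.le
        exact (pow_le_pow_right₀ (by norm_num) (by omega)).trans (two_pow_le_qprod hq2 (n + 2))
      have h4 : C < ((2 : ℝ) ^ s) ^ n * |x - y| := (div_lt_iff₀ hd).1 hn
      have hC : 0 < C := by
        have : 0 < C * qprod c n := lt_of_lt_of_le (by positivity) h3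
        exact pos_of_mul_pos_left this (qprod_pos hc n).le
      have h5 := mul_le_mul_of_nonneg_right h3 hd.le
      nlinarith

lemma one_le_dimH_of_cantorValue_mem {q c low : ℕ → ℕ} (hc : ∀ n, 1 ≤ c n)
    (hq : ∀ n, low n + c n + 1 ≤ q n)
    (growth : ∀ s : ℝ, 0 < s → s < 1 → ∃ C : ℝ, ∀ n, qprod q (n + 2) ^ s ≤ C * qprod c n)
    {S : Set ℝ} (hS : ∀ y ∈ Set.Ico (0 : ℝ) 1,
      cantorValue q (fun n => low n + qdigit c y n) ∈ S) : 1 ≤ dimH S := by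
  set g : ℝ → ℝ := fun y => cantorValue q (fun n => low n + qdigit c y n) with hg
  have hdimI : dimH (Set.Ico (0 : ℝ) 1) = 1 := by
    rw [Real.dimH_of_nonempty_interior (by simp)]
    simp
  refine ENNReal.le_of_forall_nnreal_lt fun s hs => ?_
  have hs1 : s < 1 := by exact_mod_cast hs
  rcases eq_or_lt_of_le (zero_le (a := s)) with rfl | hs0
  · simp
  obtain ⟨C, hC⟩ := growth s (by exact_mod_cast hs0) (by exact_mod_cast hs1)
  have expand : ∀ x ∈ Set.Ico (0 : ℝ) 1, ∀ y ∈ Set.Ico (0 : ℝ) 1,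
      |x - y| ≤ C * |g x - g y| ^ (s : ℝ) := fun x hx y hy =>
    abs_sub_le_rpow_abs_sub hc hq (by exact_mod_cast hs0) hC hx hy
  have hinj : Set.InjOn g (Set.Ico (0 : ℝ) 1) := by
    intro x hx y hy hxy
    have h1 := expand x hx y hy
    rw [hxy, sub_self, abs_zero, Real.zero_rpow (by exact_mod_cast hs0.ne'), mul_zero] at h1
    exact sub_eq_zero.1 (abs_eq_zero.1 (le_antisymm h1 (abs_nonneg _)))
  have hinv : ∀ x ∈ Set.Ico (0 : ℝ) 1, Function.invFunOn g (Set.Ico (0 : ℝ) 1) (g x) = x :=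
    fun x hx => hinj.leftInvOn_invFunOn hx
  have hholder : HolderOnWith C.toNNReal s (Function.invFunOn g (Set.Ico (0 : ℝ) 1))
      (g '' Set.Ico (0 : ℝ) 1) := by
    rintro _ ⟨x, hx, rfl⟩ _ ⟨y, hy, rfl⟩
    rw [hinv x hx, hinv y hy, edist_dist, edist_dist, Real.dist_eq, Real.dist_eq,
      ENNReal.ofReal_rpow_of_nonneg (abs_nonneg _) s.coe_nonneg]
    change _ ≤ ENNReal.ofReal C * _
    rw [← ENNReal.ofReal_mul' (by positivity)]
    exact ENNReal.ofReal_le_ofReal (expand x hx y hy)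
  have himage : Function.invFunOn g (Set.Ico (0 : ℝ) 1) '' (g '' Set.Ico (0 : ℝ) 1) =
      Set.Ico (0 : ℝ) 1 := by
    rw [Set.image_image]
    exact (Set.image_congr hinv).trans (Set.image_id' _)
  have h1 := hholder.dimH_image_le hs0
  rw [himage, hdimI, ENNReal.le_div_iff_mul_le (by simp [hs0.ne']) (by simp), one_mul] at h1
  refine h1.trans (dimH_mono ?_)
  rintro _ ⟨x, hx, rfl⟩
  exact hS x hx

/-! ### Stages of the construction -/

/-- The first position of stage `t`. -/
def stageStart (t : ℕ) : ℕ := t * t.factorial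

/-- The slowly growing parameter governing stage `t`: words of stage `t` have length at most
`stageDepth t` and letters less than `stageDepth t`. -/
def stageDepth (t : ℕ) : ℕ :=
  Nat.findGreatest (fun d => (2 ^ ((d + 1) * d)) ^ 2 ≤ t + 1) t

/-- The number of positions of stage `t` at which the basic sequence is small. -/
def stageLength (t : ℕ) : ℕ := 2 ^ ((stageDepth t + 1) * stageDepth t)

/-- The stage to which the position `n` belongs. -/
def stageOf (n : ℕ) : ℕ := Nat.findGreatest (fun t => stageStart t ≤ n) n

lemma stageStart_succ (t : ℕ) :
    stageStart (t + 1) = stageStart t + (t ^ 2 + t + 1) * t.factorial := by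
  rw [stageStart, stageStart, Nat.factorial_succ]
  ring

lemma stageStart_lt_succ (t : ℕ) : stageStart t < stageStart (t + 1) := by
  rw [stageStart_succ]
  have := t.factorial_pos
  exact Nat.lt_add_of_pos_right (by positivity)

lemma stageStart_strictMono : StrictMono stageStart := strictMono_nat_of_lt_succ stageStart_lt_succ

lemma le_stageStart (t : ℕ) : t ≤ stageStart t :=
  Nat.le_mul_of_pos_right _ t.factorial_pos

lemma stageStart_stageOf_le (n : ℕ) : stageStart (stageOf n) ≤ n :=
  Nat.findGreatest_spec (P := fun t => stageStart t ≤ n) (Nat.zero_le n) (by simp [stageStart])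

lemma le_stageOf_iff {t n : ℕ} : t ≤ stageOf n ↔ stageStart t ≤ n := by
  constructor
  · intro h
    exact (stageStart_strictMono.monotone h).trans (stageStart_stageOf_le n)
  · intro h
    exact Nat.le_findGreatest ((le_stageStart t).trans h) h

lemma lt_stageStart_stageOf_succ (n : ℕ) : n < stageStart (stageOf n + 1) := by
  rw [← not_le, ← le_stageOf_iff]
  omega

lemma stageOf_le (n : ℕ) : stageOf n ≤ n := Nat.findGreatest_le n

lemma stageOf_eq_iff {t n : ℕ} :
    stageOf n = t ↔ n ∈ Finset.Ico (stageStart t) (stageStart (t + 1)) := by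
  rw [Finset.mem_Ico, ← le_stageOf_iff, ← not_le, ← le_stageOf_iff]
  omega

lemma tendsto_stageOf : Tendsto stageOf atTop atTop :=
  tendsto_atTop.2 fun t => (eventually_ge_atTop (stageStart t)).mono fun _ h => le_stageOf_iff.2 h

lemma stageLength_sq_le (t : ℕ) : stageLength t ^ 2 ≤ t + 1 :=
  Nat.findGreatest_spec (P := fun d => (2 ^ ((d + 1) * d)) ^ 2 ≤ t + 1) (Nat.zero_le t) (by simp)

lemma stageLength_pos (t : ℕ) : 1 ≤ stageLength t := Nat.one_le_two_pow

lemma stageLength_le (t : ℕ) : stageLength t ≤ t + 1 :=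
  (Nat.le_self_pow two_ne_zero _).trans (stageLength_sq_le t)

lemma two_pow_stageDepth_succ_le_stageLength {t : ℕ} (h : stageDepth t ≠ 0) :
    2 ^ (stageDepth t + 1) ≤ stageLength t :=
  Nat.pow_le_pow_right two_pos (Nat.le_mul_of_pos_right _ (Nat.pos_of_ne_zero h))

lemma stageDepth_lt_factorial (t : ℕ) : stageDepth t < t.factorial := by
  refine (?_ : stageDepth t ≤ t - 1 ∧ (t = 0 → stageDepth t = 0)).elim fun h h0 => ?_
  · refine ⟨?_, fun h => by simp [h, stageDepth]⟩
    rcases eq_or_ne (stageDepth t) 0 with h | h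
    · omega
    · have h1 := two_pow_stageDepth_succ_le_stageLength h
      have h2 := stageLength_le t
      have h3 : stageDepth t + 1 < 2 ^ (stageDepth t + 1) := Nat.lt_two_pow_self
      omega
  · rcases Nat.eq_zero_or_pos t with rfl | ht
    · simp [h0]
    · have := t.self_le_factorial
      omega

lemma stageDepth_le (t : ℕ) : stageDepth t ≤ t := Nat.findGreatest_le t

lemma tendsto_stageDepth : Tendsto stageDepth atTop atTop := by
  refine tendsto_atTop.2 fun d => ?_
  filter_upwards [eventually_ge_atTop d, eventually_ge_atTop ((2 ^ ((d + 1) * d)) ^ 2)] with t h1 h2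
  exact Nat.le_findGreatest h1 (h2.trans t.le_succ)

/-- The expected number of occurrences in stage `t` of a block of length `k`. -/
noncomputable def stageWeight (k t : ℕ) : ℝ :=
  (stageLength t : ℝ) / ((2 : ℝ) ^ (stageDepth t + 1)) ^ k

/-- The expected number of occurrences, in the stages before that of `n`, of a block of
length `k`. -/
noncomputable def refSum (k n : ℕ) : ℝ := ∑ t ∈ Finset.range (stageOf n), stageWeight k t

lemma stageWeight_pos (k t : ℕ) : 0 < stageWeight k t := by
  have : (0 : ℝ) < stageLength t := by exact_mod_cast stageLength_pos t
  unfold stageWeight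
  positivity

lemma stageWeight_eq {k t : ℕ} (h : k ≤ stageDepth t) :
    stageWeight k t = (2 ^ ((stageDepth t + 1) * (stageDepth t - k)) : ℕ) := by
  rw [stageWeight, stageLength, div_eq_iff (by positivity)]
  push_cast
  rw [← pow_mul, ← pow_add, ← mul_add, Nat.sub_add_cancel h]

lemma tendsto_stageWeight (k : ℕ) : Tendsto (stageWeight k) atTop atTop := by
  have h1 : Tendsto (fun t => ((stageDepth t : ℕ) : ℝ)) atTop atTop :=
    tendsto_natCast_atTop_atTop.comp tendsto_stageDepth
  refine tendsto_atTop_mono' _ ?_ h1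
  filter_upwards [tendsto_stageDepth.eventually_ge_atTop (k + 1)] with t ht
  rw [stageWeight_eq (by omega)]
  norm_cast
  calc stageDepth t ≤ stageDepth t + 1 := Nat.le_succ _
    _ ≤ (stageDepth t + 1) * (stageDepth t - k) := Nat.le_mul_of_pos_right _ (by omega)
    _ ≤ _ := Nat.lt_two_pow_self.le

lemma stageWeight_le (k t : ℕ) : stageWeight k t ≤ √(t + 1) := by
  have h1 : stageWeight k t ≤ stageLength t :=
    div_le_self (Nat.cast_nonneg _) (one_le_pow₀ (one_le_pow₀ (by norm_num)))
  refine h1.trans (Real.le_sqrt_of_sq_le ?_)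
  exact_mod_cast stageLength_sq_le t

lemma exists_le_sum_stageWeight (k : ℕ) :
    ∃ N : ℕ, ∀ t : ℕ, (t : ℝ) - N ≤ ∑ s ∈ Finset.range t, stageWeight k s := by
  obtain ⟨N, hN⟩ := eventually_atTop.1 ((tendsto_stageWeight k).eventually_ge_atTop 1)
  refine ⟨N, fun t => ?_⟩
  induction t with
  | zero => simp
  | succ t ih =>
    rw [Finset.sum_range_succ]
    push_cast
    rcases le_or_gt N t with h | h
    · linarith [hN t h]
    · have h1 : (t : ℝ) + 1 ≤ N := by exact_mod_cast h
      have h2 : 0 ≤ ∑ s ∈ Finset.range t, stageWeight k s :=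
        Finset.sum_nonneg fun s _ => (stageWeight_pos k s).le
      linarith [stageWeight_pos k t]

lemma tendsto_sum_stageWeight (k : ℕ) :
    Tendsto (fun t => ∑ s ∈ Finset.range t, stageWeight k s) atTop atTop := by
  obtain ⟨N, hN⟩ := exists_le_sum_stageWeight k
  exact tendsto_atTop_mono hN (tendsto_atTop_add_const_right _ _ tendsto_natCast_atTop_atTop)

lemma tendsto_refSum (k : ℕ) : Tendsto (refSum k) atTop atTop :=
  (tendsto_sum_stageWeight k).comp tendsto_stageOf

lemma tendsto_sum_stageWeight_succ_div (k : ℕ) :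
    Tendsto (fun t => (∑ s ∈ Finset.range (t + 1), stageWeight k s) /
      ∑ s ∈ Finset.range t, stageWeight k s) atTop (𝓝 1) := by
  obtain ⟨N, hN⟩ := exists_le_sum_stageWeight k
  have hpos := (tendsto_sum_stageWeight k).eventually_gt_atTop 0
  have h0 : Tendsto (fun t : ℕ => stageWeight k t / ∑ s ∈ Finset.range t, stageWeight k s)
      atTop (𝓝 0) := by
    have hlim : Tendsto (fun t : ℕ => 4 / √((t : ℝ) + 1)) atTop (𝓝 0) :=
      Tendsto.const_div_atTop (Real.tendsto_sqrt_atTop.comp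
        (tendsto_atTop_add_const_right _ _ tendsto_natCast_atTop_atTop)) 4
    refine squeeze_zero' (hpos.mono fun t ht => div_nonneg (stageWeight_pos k t).le ht.le) ?_ hlim
    filter_upwards [hpos, eventually_ge_atTop (2 * N + 1)] with t ht htN
    have hs : 0 < √((t : ℝ) + 1) := Real.sqrt_pos.2 (by positivity)
    rw [div_le_div_iff₀ ht hs]
    have h1 : stageWeight k t * √((t : ℝ) + 1) ≤ t + 1 := by
      calc _ ≤ √((t : ℝ) + 1) * √((t : ℝ) + 1) := by gcongr; exact stageWeight_le k t
        _ = t + 1 := Real.mul_self_sqrt (by positivity)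
    have h2 := hN t
    have h3 : (2 : ℝ) * N + 1 ≤ t := by exact_mod_cast htN
    linarith
  have h1 := h0.const_add 1
  rw [add_zero] at h1
  refine h1.congr' ?_
  filter_upwards [hpos] with t ht
  rw [Finset.sum_range_succ, add_div, div_self ht.ne']

lemma sum_range_stageStart (h : ℕ → ℝ) (t : ℕ) :
    ∑ s ∈ Finset.range t, ∑ i ∈ Finset.Ico (stageStart s) (stageStart (s + 1)), h i =
      ∑ i ∈ Finset.range (stageStart t), h i := by
  induction t with
  | zero => simp [stageStart]
  | succ t ih =>
    rw [Finset.sum_range_succ, ih, Finset.sum_range_add_sum_Ico _ (stageStart_lt_succ t).le]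

/-- If the total of `h` over stage `t` is asymptotic to `c` times the expected number of
occurrences of blocks of length `k`, the same is true of the partial sums. -/
lemma tendsto_sum_div_refSum {h : ℕ → ℝ} (h0 : ∀ i, 0 ≤ h i) {k : ℕ} {c : ℝ}
    (H : Tendsto (fun t => (∑ i ∈ Finset.Ico (stageStart t) (stageStart (t + 1)), h i) /
      stageWeight k t) atTop (𝓝 c)) :
    Tendsto (fun n => (∑ i ∈ Finset.range n, h i) / refSum k n) atTop (𝓝 c) := by
  have hpos := (tendsto_sum_stageWeight k).eventually_gt_atTop 0
  set S : ℕ → ℝ := fun t => ∑ i ∈ Finset.range (stageStart t), h i with hS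
  have h1 : Tendsto (fun t => S t / ∑ s ∈ Finset.range t, stageWeight k s) atTop (𝓝 c) := by
    have h2 : (fun t => (∑ i ∈ Finset.Ico (stageStart t) (stageStart (t + 1)), h i) -
        c * stageWeight k t) =o[atTop] stageWeight k := by
      rw [Asymptotics.isLittleO_iff_tendsto' (.of_forall fun t ht =>
        absurd ht (stageWeight_pos k t).ne')]
      have h3 := H.sub_const c
      rw [sub_self] at h3
      refine h3.congr fun t => ?_
      rw [sub_div, mul_div_assoc, div_self (stageWeight_pos k t).ne', mul_one]
    have h4 := (h2.sum_range (fun t => (stageWeight_pos k t).le)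
      (tendsto_sum_stageWeight k)).tendsto_div_nhds_zero.add_const c
    rw [zero_add] at h4
    refine h4.congr' ?_
    filter_upwards [hpos] with t ht
    rw [Finset.sum_sub_distrib, sum_range_stageStart, ← Finset.mul_sum]
    field_simp
    ring
  have h2 : Tendsto (fun t => S (t + 1) / ∑ s ∈ Finset.range t, stageWeight k s) atTop (𝓝 c) := by
    have h3 := ((tendsto_add_atTop_iff_nat 1).2 h1).mul (tendsto_sum_stageWeight_succ_div k)
    rw [mul_one] at h3
    refine h3.congr' ?_
    filter_upwards [hpos, (tendsto_add_atTop_nat 1).eventually hpos] with t ht ht'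
    field_simp
  refine tendsto_of_tendsto_of_tendsto_of_le_of_le (h1.comp tendsto_stageOf)
    (h2.comp tendsto_stageOf) (fun n => ?_) (fun n => ?_)
  · refine div_le_div_of_nonneg_right ?_ (Finset.sum_nonneg fun s _ => (stageWeight_pos k s).le)
    exact Finset.sum_le_sum_of_subset_of_nonneg
      (Finset.range_mono (stageStart_stageOf_le n)) fun i _ _ => h0 i
  · refine div_le_div_of_nonneg_right ?_ (Finset.sum_nonneg fun s _ => (stageWeight_pos k s).le)
    exact Finset.sum_le_sum_of_subset_of_nonneg
      (Finset.range_mono (lt_stageStart_stageOf_succ n).le) fun i _ _ => h0 i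

/-! ### The basic sequence -/

/-- The basic sequence: it grows slowly on a short interval at the beginning of each stage, and
exponentially elsewhere. -/
def stagedSeq (n : ℕ) : ℕ :=
  if n < stageStart (stageOf n) + stageLength (stageOf n) then 2 ^ (stageDepth (stageOf n) + 1)
  else 2 ^ (n + 1)

lemma stageDepth_stageOf_le (n : ℕ) : stageDepth (stageOf n) ≤ n :=
  (stageDepth_le _).trans (stageOf_le n)

lemma stagedSeq_le (n : ℕ) : stagedSeq n ≤ 2 ^ (n + 1) := by
  unfold stagedSeq
  split_ifs
  · exact Nat.pow_le_pow_right two_pos (Nat.succ_le_succ (stageDepth_stageOf_le n))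
  · exact le_rfl

lemma two_pow_le_stagedSeq (n : ℕ) : 2 ^ (stageDepth (stageOf n) + 1) ≤ stagedSeq n := by
  unfold stagedSeq
  split_ifs
  · exact le_rfl
  · exact Nat.pow_le_pow_right two_pos (Nat.succ_le_succ (stageDepth_stageOf_le n))

lemma stageDepth_add_two_le_stagedSeq (n : ℕ) : stageDepth (stageOf n) + 2 ≤ stagedSeq n := by
  refine le_trans ?_ (two_pow_le_stagedSeq n)
  have := Nat.lt_two_pow_self (n := stageDepth (stageOf n) + 1)
  omega

lemma two_le_stagedSeq (n : ℕ) : 2 ≤ stagedSeq n :=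
  (Nat.le_add_left _ _).trans (stageDepth_add_two_le_stagedSeq n)

lemma tendsto_stagedSeq : Tendsto stagedSeq atTop atTop :=
  tendsto_atTop_mono
    (fun n => (Nat.le_add_right _ _).trans (stageDepth_add_two_le_stagedSeq n))
    (tendsto_stageDepth.comp tendsto_stageOf)

lemma stageStart_add_stageLength_le (t : ℕ) :
    stageStart t + stageLength t ≤ stageStart (t + 1) := by
  rw [stageStart_succ]
  refine Nat.add_le_add_left ((stageLength_le t).trans ?_) _
  exact le_trans (by nlinarith) (Nat.le_mul_of_pos_right _ t.factorial_pos)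

lemma stageStart_add_stageLength_lt {t : ℕ} (ht : 1 ≤ t) :
    stageStart t + stageLength t < stageStart (t + 1) := by
  rw [stageStart_succ]
  refine Nat.add_lt_add_left ((stageLength_le t).trans_lt ?_) _
  exact lt_of_lt_of_le (by nlinarith) (Nat.le_mul_of_pos_right _ t.factorial_pos)

/-- The expected frequency of a given block of length `k` at position `i`. -/
noncomputable def blockWeight (k i : ℕ) : ℝ := (∏ l ∈ Finset.range k, (stagedSeq (i + l) : ℝ))⁻¹

lemma blockWeight_pos (k i : ℕ) : 0 < blockWeight k i :=
  inv_pos.2 (Finset.prod_pos fun l _ => by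
    have := two_le_stagedSeq (i + l)
    exact_mod_cast (by omega : 0 < stagedSeq (i + l)))

lemma blockWeight_le_inv {k i l : ℕ} (hl : l < k) :
    blockWeight k i ≤ (stagedSeq (i + l) : ℝ)⁻¹ := by
  have h1 : ∀ j, (1 : ℝ) ≤ stagedSeq j := fun j => by
    exact_mod_cast (Nat.le_succ 1).trans (two_le_stagedSeq j)
  refine inv_anti₀ (zero_lt_one.trans_le (h1 _)) ?_
  rw [← Finset.mul_prod_erase _ _ (Finset.mem_range.2 hl)]
  refine le_mul_of_one_le_right (zero_le_one.trans (h1 _)) ?_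
  exact Finset.one_le_prod fun j _ => h1 _

lemma blockWeight_le_one (k i : ℕ) : blockWeight k i ≤ 1 := by
  refine inv_le_one_of_one_le₀ (Finset.one_le_prod fun j _ => ?_)
  exact_mod_cast (Nat.le_succ 1).trans (two_le_stagedSeq _)

lemma blockWeight_eq {k i t : ℕ} (hi : stageStart t ≤ i)
    (hik : i + k ≤ stageStart t + stageLength t) :
    blockWeight k i = (((2 : ℝ) ^ (stageDepth t + 1)) ^ k)⁻¹ := by
  rw [blockWeight, Finset.prod_congr rfl (g := fun _ => (2 : ℝ) ^ (stageDepth t + 1)),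
    Finset.prod_const, Finset.card_range]
  intro l hl
  rw [Finset.mem_range] at hl
  have h1 := stageStart_add_stageLength_le t
  have h2 : stageOf (i + l) = t := stageOf_eq_iff.2 (Finset.mem_Ico.2 ⟨by omega, by omega⟩)
  rw [stagedSeq, h2, if_pos (by omega)]
  push_cast
  rfl

lemma blockWeight_le_half_pow {k i t : ℕ} (hk : 1 ≤ k) (ht : 1 ≤ t)
    (hi : i ∈ Finset.Ico (stageStart t) (stageStart (t + 1)))
    (hik : stageStart t + stageLength t < i + k) : blockWeight k i ≤ (1 / 2 : ℝ) ^ i := by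
  rw [Finset.mem_Ico] at hi
  have h1 := stageStart_add_stageLength_lt ht
  obtain ⟨l, hl, hl1, hl2⟩ : ∃ l < k, stageStart t + stageLength t ≤ i + l ∧
      i + l < stageStart (t + 1) := by
    rcases le_or_gt (stageStart t + stageLength t) i with h | h
    · exact ⟨0, hk, by omega, by omega⟩
    · exact ⟨stageStart t + stageLength t - i, by omega, by omega, by omega⟩
  refine (blockWeight_le_inv hl).trans ?_
  have h2 : stageOf (i + l) = t := stageOf_eq_iff.2 (Finset.mem_Ico.2 ⟨by omega, by omega⟩)
  rw [stagedSeq, h2, if_neg (by omega), one_div, inv_pow]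
  push_cast
  exact inv_anti₀ (by positivity) (pow_le_pow_right₀ (by norm_num) (by omega))

lemma abs_card_filter_mod_sub_le {m r : ℕ} (hr : r < m) (a L : ℕ) :
    |(((Finset.Ico a (a + L)).filter fun i => i % m = r).card : ℝ) - L / m| ≤ 1 := by
  have hm : (0 : ℚ) < m := by exact_mod_cast (by omega : 0 < m)
  have h1 : ((Finset.Ico a (a + L)).filter fun i => i % m = r) =
      (Finset.Ico a (a + L)).filter fun i => i ≡ r [MOD m] := by
    refine Finset.filter_congr fun i _ => ?_
    rw [Nat.ModEq, Nat.mod_eq_of_lt hr]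
  have h2 := Nat.Ico_filter_modEq_card a (a + L) (by omega : 0 < m) r
  have h3 : (⌈((a + L : ℕ) - (r : ℚ)) / m⌉ : ℚ) - ⌈((a : ℚ) - r) / m⌉ ≤ L / m + 1 := by
    have h4 := Int.ceil_lt_add_one (((a + L : ℕ) - (r : ℚ)) / m)
    have h5 := Int.le_ceil (((a : ℚ) - r) / m)
    have h6 : ((a + L : ℕ) - (r : ℚ)) / m = ((a : ℚ) - r) / m + L / m := by
      push_cast
      ring
    linarith
  have h3' : (L : ℚ) / m - 1 ≤ (⌈((a + L : ℕ) - (r : ℚ)) / m⌉ : ℚ) - ⌈((a : ℚ) - r) / m⌉ := by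
    have h4 := Int.ceil_lt_add_one (((a : ℚ) - r) / m)
    have h5 := Int.le_ceil (((a + L : ℕ) - (r : ℚ)) / m)
    have h6 : ((a + L : ℕ) - (r : ℚ)) / m = ((a : ℚ) - r) / m + L / m := by
      push_cast
      ring
    linarith
  have h7 : |(((Finset.Ico a (a + L)).filter fun i => i ≡ r [MOD m]).card : ℚ) - L / m| ≤ 1 := by
    have h8 : (((Finset.Ico a (a + L)).filter fun i => i ≡ r [MOD m]).card : ℚ) =
        max ((⌈((a + L : ℕ) - (r : ℚ)) / m⌉ : ℚ) - ⌈((a : ℚ) - r) / m⌉) 0 := by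
      exact_mod_cast h2
    have h9 : (0 : ℚ) ≤ L / m := by positivity
    rw [h8, abs_le]
    constructor
    · linarith [le_max_left ((⌈((a + L : ℕ) - (r : ℚ)) / m⌉ : ℚ) - ⌈((a : ℚ) - r) / m⌉) 0]
    · rw [sub_le_iff_le_add, max_le_iff]
      constructor <;> linarith
  rw [h1]
  have h10 := (Rat.cast_le (K := ℝ)).2 h7
  push_cast at h10
  exact h10

lemma sum_half_pow_Ico_le (a b : ℕ) : ∑ i ∈ Finset.Ico a b, (1 / 2 : ℝ) ^ i ≤ 2 := by
  refine (Finset.sum_le_sum_of_subset_of_nonneg (t := Finset.range b) ?_ ?_).trans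
    (sum_geometric_two_le b)
  · rw [Finset.range_eq_Ico]
    exact Finset.Ico_subset_Ico_left (Nat.zero_le a)
  · intro i _ _
    positivity

lemma abs_sum_blockWeight_sub_le {k m r t : ℕ} (hk : 1 ≤ k) (hr : r < m) (ht : 1 ≤ t)
    (hkt : k ≤ stageLength t) :
    |(∑ i ∈ Finset.Ico (stageStart t) (stageStart (t + 1)),
      if i % m = r then blockWeight k i else 0) - stageWeight k t * (1 / m)| ≤ k + 4 := by
  have hle := stageStart_add_stageLength_le t
  set a := stageStart t with ha
  set L := stageLength t + 1 - k with hL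
  set β := (((2 : ℝ) ^ (stageDepth t + 1)) ^ k)⁻¹ with hβ
  have hβ0 : 0 < β := by positivity
  have hβ1 : β ≤ 1 := inv_le_one_of_one_le₀ (one_le_pow₀ (one_le_pow₀ (by norm_num)))
  have hcard := abs_card_filter_mod_sub_le hr a L
  set N : ℝ := (((Finset.Ico a (a + L)).filter fun i => i % m = r).card : ℝ) with hN
  have hsplit := Finset.sum_Ico_consecutive (fun i => if i % m = r then blockWeight k i else 0)
    (by omega : a ≤ a + L) (by omega : a + L ≤ stageStart (t + 1))
  have hmain : ∑ i ∈ Finset.Ico a (a + L), (if i % m = r then blockWeight k i else 0) = N * β := by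
    rw [← Finset.sum_filter, hN, ← nsmul_eq_mul]
    refine Finset.sum_eq_card_nsmul fun i hi => ?_
    have hi' := Finset.mem_Ico.1 (Finset.mem_filter.1 hi).1
    exact blockWeight_eq hi'.1 (by omega)
  have htail0 : 0 ≤ ∑ i ∈ Finset.Ico (a + L) (stageStart (t + 1)),
      (if i % m = r then blockWeight k i else 0) :=
    Finset.sum_nonneg fun i _ => by split_ifs; exacts [(blockWeight_pos k i).le, le_rfl]
  have htail : ∑ i ∈ Finset.Ico (a + L) (stageStart (t + 1)),
      (if i % m = r then blockWeight k i else 0) ≤ 2 := by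
    refine (Finset.sum_le_sum fun i hi => ?_).trans
      (sum_half_pow_Ico_le (a + L) (stageStart (t + 1)))
    have hi' := Finset.mem_Ico.1 hi
    split_ifs
    · exact blockWeight_le_half_pow hk ht (Finset.mem_Ico.2 ⟨by omega, hi'.2⟩) (by omega)
    · positivity
  have hm : (1 : ℝ) ≤ m := by exact_mod_cast (by omega : 1 ≤ m)
  have hweight : stageWeight k t * (1 / m) = (L / m + ((k : ℝ) - 1) / m) * β := by
    have : (L : ℝ) + k = stageLength t + 1 := by exact_mod_cast (by omega : L + k = _)
    rw [stageWeight, hβ, ← add_div, show (L : ℝ) + ((k : ℝ) - 1) = stageLength t by linarith]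
    field_simp
  have hk' : (1 : ℝ) ≤ k := by exact_mod_cast hk
  have hk1 : ((k : ℝ) - 1) / m ≤ k - 1 := div_le_self (by linarith) hm
  have hk0 : 0 ≤ ((k : ℝ) - 1) / m := div_nonneg (by linarith) (by linarith)
  rw [← hsplit, hmain, hweight]
  rw [abs_le] at hcard ⊢
  constructor <;> nlinarith

lemma tendsto_div_stageWeight_of_abs_sub_le {k : ℕ} {f : ℕ → ℝ} {c K : ℝ}
    (h : ∀ᶠ t in atTop, |f t - stageWeight k t * c| ≤ K) :
    Tendsto (fun t => f t / stageWeight k t) atTop (𝓝 c) := by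
  rw [tendsto_iff_norm_sub_tendsto_zero]
  refine squeeze_zero' (.of_forall fun t => norm_nonneg _) ?_
    ((tendsto_stageWeight k).const_div_atTop K)
  filter_upwards [h] with t ht
  have hp := stageWeight_pos k t
  have h1 : f t / stageWeight k t - c = (f t - stageWeight k t * c) / stageWeight k t := by
    field_simp
  rw [h1, Real.norm_eq_abs, abs_div, abs_of_pos hp]
  gcongr

lemma tendsto_stageLength : Tendsto stageLength atTop atTop := by
  refine tendsto_atTop_mono' _ ?_ tendsto_stageDepth
  filter_upwards [tendsto_stageDepth.eventually_ge_atTop 1] with t ht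
  refine le_trans ?_ (two_pow_stageDepth_succ_le_stageLength (by omega))
  exact (Nat.le_succ _).trans Nat.lt_two_pow_self.le

lemma tendsto_sum_blockWeight_div_refSum {k m r : ℕ} (hk : 1 ≤ k) (hr : r < m) :
    Tendsto (fun n => (∑ i ∈ Finset.range n, if i % m = r then blockWeight k i else 0) /
      refSum k n) atTop (𝓝 (1 / m)) := by
  refine tendsto_sum_div_refSum
    (fun i => by split_ifs; exacts [(blockWeight_pos k i).le, le_rfl]) ?_
  refine tendsto_div_stageWeight_of_abs_sub_le (K := k + 4) ?_
  filter_upwards [eventually_ge_atTop 1, tendsto_stageLength.eventually_ge_atTop k] with t h1 h2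
  exact abs_sum_blockWeight_sub_le hk hr h1 h2

lemma tendsto_Qsum_div_refSum {k : ℕ} (hk : 1 ≤ k) :
    Tendsto (fun n => Qsum stagedSeq k n / refSum k n) atTop (𝓝 1) := by
  have h := tendsto_sum_blockWeight_div_refSum hk (zero_lt_one)
  simp only [Nat.mod_one, if_true, Nat.cast_one, div_one] at h
  exact h

lemma apQsum_eq {m r n : ℕ} (hr : r < m) (hn : r ≤ n) :
    apQsum stagedSeq m r n =
      ∑ i ∈ Finset.range (n + 1), if i % m = r then blockWeight m i else 0 := by
  rw [← Finset.sum_filter, apQsum]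
  have hm : 0 < m := by omega
  refine Finset.sum_nbij' (fun j => m * j + r) (fun i => i / m) ?_ ?_ ?_ ?_ ?_
  · intro j hj
    rw [Finset.mem_range, Nat.lt_succ_iff, Nat.le_div_iff_mul_le hm] at hj
    rw [Finset.mem_filter, Finset.mem_range, Nat.mul_add_mod, Nat.mod_eq_of_lt hr]
    refine ⟨?_, rfl⟩
    rw [mul_comm] at hj
    omega
  · intro i hi
    rw [Finset.mem_filter, Finset.mem_range] at hi
    rw [Finset.mem_range, Nat.lt_succ_iff, Nat.le_div_iff_mul_le hm]
    have := Nat.div_add_mod' i m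
    omega
  · intro j _
    rw [Nat.mul_add_div hm, Nat.div_eq_of_lt hr, add_zero]
  · intro i hi
    have h1 := (Finset.mem_filter.1 hi).2
    have h2 := Nat.div_add_mod i m
    change m * (i / m) + r = i
    omega
  · intro j _
    rfl

lemma tendsto_apQsum_div_refSum {m r : ℕ} (hr : r < m) :
    Tendsto (fun n => apQsum stagedSeq m r n / refSum m n) atTop (𝓝 (1 / m)) := by
  have h1 := tendsto_sum_blockWeight_div_refSum (k := m) (by omega) hr
  have h2 : Tendsto (fun n => (if n % m = r then blockWeight m n else 0) / refSum m n)
      atTop (𝓝 0) := by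
    refine squeeze_zero' ?_ ?_ ((tendsto_refSum m).const_div_atTop 1)
    · filter_upwards [(tendsto_refSum m).eventually_gt_atTop 0] with n hn
      refine div_nonneg ?_ hn.le
      split_ifs
      exacts [(blockWeight_pos m n).le, le_rfl]
    · filter_upwards [(tendsto_refSum m).eventually_gt_atTop 0] with n hn
      gcongr
      split_ifs
      exacts [blockWeight_le_one m n, zero_le_one]
  have h3 := h1.add h2
  rw [add_zero] at h3
  refine h3.congr' ?_
  filter_upwards [eventually_ge_atTop r] with n hn
  rw [apQsum_eq hr hn, Finset.sum_range_succ, add_div]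

lemma Qsum_lamQ_two_one (n : ℕ) : Qsum (lamQ stagedSeq 2 1) 1 n =
    ∑ i ∈ Finset.range (2 * n), if i % 2 = 1 then blockWeight 1 i else 0 := by
  induction n with
  | zero => simp [Qsum]
  | succ n ih =>
    rw [mul_add, Finset.sum_range_succ, Finset.sum_range_succ, ← ih, Qsum, Finset.sum_range_succ,
      ← Qsum, if_neg (by omega), if_pos (by omega), add_zero]
    simp [blockWeight, lamQ]

/-! ### Lists of words -/

/-- Every word of length `1 ≤ k ≤ d` with letters less than `d`, taken with a multiplicity
proportional to the expected frequency `2 ^ (-(d + 1) * k)`. -/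
def wordMultiset (d : ℕ) : Multiset (List ℕ) :=
  ∑ k ∈ Finset.Icc 1 d, ∑ v ∈ Fintype.piFinset fun _ : Fin k => Finset.range d,
    Multiset.replicate (2 ^ ((d + 1) * (d - k))) (List.ofFn v)

/-- The `s`-th word of an enumeration of `wordMultiset d`, continued by empty words. -/
noncomputable def wordAt (d s : ℕ) : List ℕ := (wordMultiset d).toList.getD s []

lemma wordAt_mem_or (d s : ℕ) : wordAt d s = [] ∨ wordAt d s ∈ wordMultiset d := by
  rcases lt_or_ge s (wordMultiset d).toList.length with h | h
  · right
    rw [wordAt, List.getD_eq_getElem _ _ h]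
    exact Multiset.mem_toList.1 (List.getElem_mem h)
  · left
    exact List.getD_eq_default _ _ h

lemma mem_wordMultiset {d : ℕ} {w : List ℕ} (h : w ∈ wordMultiset d) :
    w.length ≤ d ∧ ∀ a ∈ w, a < d := by
  obtain ⟨k, hk, h⟩ := Multiset.mem_sum.1 h
  obtain ⟨v, hv, h⟩ := Multiset.mem_sum.1 h
  rw [Multiset.eq_of_mem_replicate h]
  refine ⟨by simpa using (Finset.mem_Icc.1 hk).2, fun a ha => ?_⟩
  obtain ⟨j, rfl⟩ := (List.mem_ofFn' _ _).1 ha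
  exact Finset.mem_range.1 (Fintype.mem_piFinset.1 hv j)

lemma length_wordAt_le (d s : ℕ) : (wordAt d s).length ≤ d := by
  rcases wordAt_mem_or d s with h | h
  · simp [h]
  · exact (mem_wordMultiset h).1

lemma wordAt_getD_lt {d s j : ℕ} (hj : j < (wordAt d s).length) : (wordAt d s).getD j 0 < d := by
  rcases wordAt_mem_or d s with h | h
  · simp [h] at hj
  · rw [List.getD_eq_getElem _ _ hj]
    exact (mem_wordMultiset h).2 _ (List.getElem_mem hj)

lemma card_filter_getD {α : Type*} (p : α → Prop) [DecidablePred p] {a : α} (ha : ¬ p a)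
    (l : List α) {N : ℕ} (hN : l.length ≤ N) :
    ((Finset.range N).filter fun s => p (l.getD s a)).card = Multiset.countP p (l : Multiset α) := by
  rw [Finset.card_filter]
  induction l generalizing N with
  | nil => simp [ha]
  | cons b l ih =>
    obtain ⟨N, rfl⟩ : ∃ M, N = M + 1 := ⟨N - 1, by simp at hN; omega⟩
    rw [Finset.sum_range_succ', ← Multiset.cons_coe, Multiset.countP_cons]
    simp only [List.getD_cons_succ, List.getD_cons_zero]
    rw [ih (by simpa using hN)]

lemma countP_wordMultiset (p : List ℕ → Prop) [DecidablePred p] (d : ℕ) :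
    Multiset.countP p (wordMultiset d) =
      ∑ k ∈ Finset.Icc 1 d, ∑ v ∈ Fintype.piFinset fun _ : Fin k => Finset.range d,
        if p (List.ofFn v) then 2 ^ ((d + 1) * (d - k)) else 0 := by
  rw [← Multiset.coe_countPAddMonoidHom, wordMultiset, map_sum]
  refine Finset.sum_congr rfl fun k _ => ?_
  rw [map_sum]
  refine Finset.sum_congr rfl fun v _ => ?_
  rw [Multiset.coe_countPAddMonoidHom, ← Multiset.coe_replicate, Multiset.coe_countP,
    List.countP_replicate]
  simp

lemma le_two_pow_succ (d : ℕ) : d ≤ 2 ^ (d + 1) :=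
  (Nat.le_succ d).trans Nat.lt_two_pow_self.le

lemma pow_mul_two_pow_le {d k l : ℕ} (hkl : k ≤ l) (hl : l ≤ d) :
    d ^ l * 2 ^ ((d + 1) * (d - l)) ≤ d ^ k * 2 ^ ((d + 1) * (d - k)) := by
  obtain ⟨j, rfl⟩ := Nat.exists_eq_add_of_le hkl
  have h1 : d - k = j + (d - (k + j)) := by omega
  rw [h1, mul_add, pow_add 2, pow_add, mul_assoc]
  refine Nat.mul_le_mul_left _ (Nat.mul_le_mul_right _ ?_)
  rw [pow_mul]
  exact Nat.pow_le_pow_left (le_two_pow_succ d) j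

lemma countP_length_wordMultiset_le (d k : ℕ) :
    Multiset.countP (fun w => k < w.length) (wordMultiset d) ≤
      d * (d ^ (k + 1) * 2 ^ ((d + 1) * (d - (k + 1)))) := by
  rw [countP_wordMultiset]
  refine (Finset.sum_le_card_nsmul _ _ (d ^ (k + 1) * 2 ^ ((d + 1) * (d - (k + 1)))) ?_).trans ?_
  · intro l hl
    simp only [List.length_ofFn]
    split_ifs with h
    · simpa using pow_mul_two_pow_le (Nat.succ_le_of_lt h) (Finset.mem_Icc.1 hl).2
    · simp
  · simp

lemma card_wordMultiset_le (d : ℕ) : (wordMultiset d).card ≤ d * 2 ^ ((d + 1) * d) := by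
  have h1 : (wordMultiset d).card = Multiset.countP (fun _ => True) (wordMultiset d) := by simp
  rw [h1, countP_wordMultiset]
  refine (Finset.sum_le_card_nsmul _ _ (2 ^ ((d + 1) * d)) ?_).trans ?_
  · intro l hl
    simpa using pow_mul_two_pow_le (Nat.zero_le l) (Finset.mem_Icc.1 hl).2
  · simp

lemma count_ofFn_wordMultiset {d k : ℕ} (hk : 1 ≤ k) (hkd : k ≤ d) {B : Fin k → ℕ}
    (hB : ∀ j, B j < d) :
    Multiset.countP (fun w => w = List.ofFn B) (wordMultiset d) = 2 ^ ((d + 1) * (d - k)) := by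
  rw [countP_wordMultiset, Finset.sum_eq_single_of_mem k (Finset.mem_Icc.2 ⟨hk, hkd⟩),
    Finset.sum_eq_single_of_mem B]
  · simp
  · exact Fintype.mem_piFinset.2 fun j => Finset.mem_range.2 (hB j)
  · intro v _ hv
    exact if_neg fun h => hv (List.ofFn_injective h)
  · intro l _ hl
    refine Finset.sum_eq_zero fun v _ => if_neg fun h => hl ?_
    simpa using congrArg List.length h

lemma card_filter_wordAt {p : List ℕ → Prop} [DecidablePred p] (hp : ¬ p []) {d N : ℕ}
    (hN : (wordMultiset d).card ≤ N) :
    ((Finset.range N).filter fun s => p (wordAt d s)).card = Multiset.countP p (wordMultiset d) := by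
  have h := card_filter_getD p hp (wordMultiset d).toList (N := N) (by simpa using hN)
  rwa [Multiset.coe_toList] at h

lemma card_wordMultiset_stageDepth_le (t : ℕ) :
    (wordMultiset (stageDepth t)).card ≤ t ^ 2 + t + 1 := by
  have h1 := card_wordMultiset_le (stageDepth t)
  have h2 := Nat.mul_le_mul (stageDepth_le t) (stageLength_le t)
  rw [stageLength] at h2
  nlinarith

/-! ### Digits prescribed by the words, and free digits -/

lemma stageOf_le_div_factorial (n : ℕ) : stageOf n ≤ n / (stageOf n).factorial :=
  (Nat.le_div_iff_mul_le (Nat.factorial_pos _)).2 (stageStart_stageOf_le n)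

lemma div_factorial_sub_lt (n : ℕ) :
    n / (stageOf n).factorial - stageOf n < stageOf n ^ 2 + stageOf n + 1 := by
  have h1 := lt_stageStart_stageOf_succ n
  rw [stageStart_succ, stageStart, ← add_mul] at h1
  have h2 := (Nat.div_lt_iff_lt_mul (Nat.factorial_pos (stageOf n))).2 h1
  omega

/-- The distance from the position `n` to the beginning of its slot. -/
def slotOffset (n : ℕ) : ℕ := n % (stageOf n).factorial

/-- The word written at the beginning of the slot of `n`. -/
noncomputable def slotWord (n : ℕ) : List ℕ :=
  wordAt (stageDepth (stageOf n)) (n / (stageOf n).factorial - stageOf n)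

/-- The smallest digit allowed at position `n`. -/
noncomputable def lowDigit (n : ℕ) : ℕ :=
  if slotOffset n < (slotWord n).length then (slotWord n).getD (slotOffset n) 0
  else stageDepth (stageOf n)

/-- The number of digits allowed at position `n`. -/
noncomputable def digitChoices (n : ℕ) : ℕ :=
  if slotOffset n < (slotWord n).length then 1 else stagedSeq n - 1 - stageDepth (stageOf n)

lemma one_le_digitChoices (n : ℕ) : 1 ≤ digitChoices n := by
  have := stageDepth_add_two_le_stagedSeq n
  unfold digitChoices
  split_ifs <;> omega

lemma lowDigit_add_digitChoices_le (n : ℕ) : lowDigit n + digitChoices n + 1 ≤ stagedSeq n := by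
  have h := stageDepth_add_two_le_stagedSeq n
  unfold digitChoices lowDigit
  split_ifs with h1
  · have h2 : (slotWord n).getD (slotOffset n) 0 < stageDepth (stageOf n) := wordAt_getD_lt h1
    omega
  · omega

lemma two_pow_le_digitChoices {n : ℕ} (h : stageOf n < slotOffset n) :
    2 ^ n ≤ digitChoices n := by
  have hd := stageDepth_le (stageOf n)
  have h1 : (slotWord n).length ≤ stageDepth (stageOf n) := length_wordAt_le _ _
  have h2 : ¬ n < stageStart (stageOf n) + stageLength (stageOf n) := by
    intro hn
    have h3 := stageLength_le (stageOf n)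
    obtain ⟨j, hj⟩ := Nat.exists_eq_add_of_le (stageStart_stageOf_le n)
    have h4 : slotOffset n ≤ j := by
      rw [slotOffset]
      nth_rw 1 [hj]
      rw [stageStart, Nat.mul_add_mod']
      exact Nat.mod_le _ _
    omega
  rw [digitChoices, if_neg (by omega), stagedSeq, if_neg h2, pow_succ]
  have h3 := stageDepth_stageOf_le n
  have h4 := Nat.lt_two_pow_self (n := n)
  omega

/-- The number of positions less than `n` lying near the beginning of their slot. -/
def nearCount (n : ℕ) : ℕ := ((Finset.range n).filter fun i => slotOffset i ≤ stageOf i).card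

lemma nearCount_le (n : ℕ) : nearCount n ≤ (stageOf n + 1) ^ 4 := by
  have key : ∀ t ∈ Finset.range (stageOf n + 1),
      (((Finset.range n).filter fun i => slotOffset i ≤ stageOf i).filter
        fun i => stageOf i = t).card ≤ (stageOf n + 1) ^ 3 := by
    intro t ht
    rw [Finset.mem_range] at ht
    refine (Finset.card_le_card_of_injOn
      (t := Finset.range (t ^ 2 + t + 1) ×ˢ Finset.range (t + 1))
      (fun i => (i / t.factorial - t, i % t.factorial)) ?_ ?_).trans ?_
    · intro i hi
      simp only [Finset.coe_filter, Finset.mem_filter, Set.mem_ofPred_eq] at hi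
      obtain ⟨⟨-, h1⟩, rfl⟩ := hi
      exact Finset.mem_coe.2 (Finset.mem_product.2 ⟨Finset.mem_range.2 (div_factorial_sub_lt i),
        Finset.mem_range.2 (Nat.lt_succ_of_le h1)⟩)
    · intro i hi j hj hij
      simp only [Finset.coe_filter, Finset.mem_filter, Set.mem_ofPred_eq] at hi hj
      have h1 := stageOf_le_div_factorial i
      have h2 := stageOf_le_div_factorial j
      rw [hi.2] at h1
      rw [hj.2] at h2
      simp only [Prod.mk.injEq] at hij
      rw [← Nat.div_add_mod i t.factorial, ← Nat.div_add_mod j t.factorial, hij.2,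
        (by omega : i / t.factorial = j / t.factorial)]
    · rw [Finset.card_product, Finset.card_range, Finset.card_range]
      have h1 : t ^ 2 + t + 1 ≤ (t + 1) ^ 2 := by nlinarith
      calc (t ^ 2 + t + 1) * (t + 1) ≤ (t + 1) ^ 2 * (t + 1) := Nat.mul_le_mul_right _ h1
        _ = (t + 1) ^ 3 := by ring
        _ ≤ _ := Nat.pow_le_pow_left ht _
  have h := Finset.card_le_mul_card_image_of_maps_to (f := stageOf)
    (s := (Finset.range n).filter fun i => slotOffset i ≤ stageOf i)
    (t := Finset.range (stageOf n + 1)) ?_ _ key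
  · rw [Finset.card_range] at h
    exact h.trans_eq (by ring)
  · intro i hi
    rw [Finset.mem_filter, Finset.mem_range] at hi
    exact Finset.mem_range.2 (Nat.lt_succ_of_le
      (le_stageOf_iff.2 ((stageStart_stageOf_le i).trans hi.1.le)))

lemma tendsto_nearCount_div : Tendsto (fun n => (nearCount n : ℝ) / n) atTop (𝓝 0) := by
  have h0 : Tendsto (fun t : ℕ => 16 * (((t : ℝ) ^ 4 / 2 ^ t) * (2 ^ t / t.factorial)))
      atTop (𝓝 0) := by
    simpa using ((tendsto_pow_const_div_const_pow_of_one_lt 4 (one_lt_two (α := ℝ))).mul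
      (FloorSemiring.tendsto_pow_div_factorial_atTop (2 : ℝ))).const_mul 16
  refine squeeze_zero' (.of_forall fun n => by positivity) ?_ (h0.comp tendsto_stageOf)
  filter_upwards [tendsto_stageOf.eventually_ge_atTop 1] with n hn
  have h1 : (nearCount n : ℝ) ≤ ((stageOf n : ℝ) + 1) ^ 4 := by exact_mod_cast nearCount_le n
  have h2 : ((stageOf n).factorial : ℝ) ≤ n := by
    exact_mod_cast (Nat.le_mul_of_pos_left _ hn).trans (stageStart_stageOf_le n)
  have h3 : (0 : ℝ) < (stageOf n).factorial := by exact_mod_cast Nat.factorial_pos _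
  have h4 : (1 : ℝ) ≤ stageOf n := by exact_mod_cast hn
  have h5 : ((stageOf n : ℝ) + 1) ^ 4 ≤ 16 * (stageOf n : ℝ) ^ 4 := by
    calc ((stageOf n : ℝ) + 1) ^ 4 ≤ (2 * (stageOf n : ℝ)) ^ 4 := by gcongr; linarith
      _ = _ := by ring
  simp only [Function.comp]
  rw [div_mul_div_cancel₀ (by positivity), ← mul_div_assoc]
  exact div_le_div₀ (by positivity) (h1.trans h5) h3 h2

lemma two_pow_sum_le_qprod_digitChoices (n : ℕ) :
    (2 : ℝ) ^ (∑ i ∈ Finset.range n, i) ≤ qprod digitChoices n * 2 ^ (n * nearCount n) := by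
  have h1 : (2 : ℝ) ^ (n * nearCount n) =
      ∏ i ∈ Finset.range n, if slotOffset i ≤ stageOf i then (2 : ℝ) ^ n else 1 := by
    rw [Finset.prod_ite, Finset.prod_const, Finset.prod_const_one, mul_one, pow_mul, nearCount]
  rw [h1, qprod, ← Finset.prod_mul_distrib, ← Finset.prod_pow_eq_pow_sum]
  refine Finset.prod_le_prod (fun i _ => by positivity) fun i hi => ?_
  split_ifs with h
  · have h2 : (1 : ℝ) ≤ digitChoices i := by exact_mod_cast one_le_digitChoices i
    have h3 : (2 : ℝ) ^ i ≤ 2 ^ n := pow_le_pow_right₀ one_le_two (Finset.mem_range.1 hi).le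
    nlinarith [pow_pos (two_pos (α := ℝ)) n]
  · rw [mul_one]
    exact_mod_cast two_pow_le_digitChoices (not_le.1 h)

lemma qprod_stagedSeq_le (n : ℕ) :
    qprod stagedSeq n ≤ (2 : ℝ) ^ (∑ i ∈ Finset.range n, (i + 1)) := by
  rw [qprod, ← Finset.prod_pow_eq_pow_sum]
  exact Finset.prod_le_prod (fun i _ => by positivity) fun i _ => by exact_mod_cast stagedSeq_le i

lemma exists_qprod_stagedSeq_rpow_le {s : ℝ} (h0 : 0 < s) (h1 : s < 1) :
    ∃ C : ℝ, ∀ n, qprod stagedSeq (n + 2) ^ s ≤ C * qprod digitChoices n := by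
  have hc : ∀ n, 0 < qprod digitChoices n := fun n =>
    Finset.prod_pos fun i _ => by exact_mod_cast one_le_digitChoices i
  have hq : ∀ n, 0 < qprod stagedSeq n := fun n => Finset.prod_pos fun i _ => by
    exact_mod_cast two_pos.trans_le (two_le_stagedSeq i)
  have hsum : ∀ n : ℕ, ((∑ i ∈ Finset.range n, i : ℕ) : ℝ) = n * (n - 1) / 2 := fun n => by
    induction n with
    | zero => simp
    | succ n ih => rw [Finset.sum_range_succ, Nat.cast_add, ih]; push_cast; ring
  have hev : ∀ᶠ n : ℕ in atTop, qprod stagedSeq (n + 2) ^ s ≤ qprod digitChoices n := by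
    have hlim := tendsto_nearCount_div.eventually (gt_mem_nhds (by linarith : 0 < (1 - s) / 4))
    have hbig := tendsto_natCast_atTop_atTop (R := ℝ) |>.eventually_ge_atTop (24 / (1 - s) + 1)
    filter_upwards [hlim, hbig] with n hn1 hn2
    have hn0 : (1 : ℝ) < n := by
      have : 0 < 24 / (1 - s) := div_pos (by norm_num) (by linarith)
      linarith
    rw [div_lt_iff₀ (by linarith)] at hn1
    have hn3 : 24 ≤ (1 - s) * (n - 1) := by
      rw [mul_comm, ← div_le_iff₀ (by linarith)]
      linarith
    refine (Real.rpow_le_rpow (hq _).le (qprod_stagedSeq_le _) h0.le).trans ?_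
    have h2 := two_pow_sum_le_qprod_digitChoices n
    rw [← div_le_iff₀ (by positivity)] at h2
    refine le_trans ?_ h2
    rw [← Real.rpow_natCast, ← Real.rpow_natCast, ← Real.rpow_natCast, ← Real.rpow_mul two_pos.le,
      ← Real.rpow_sub two_pos]
    refine Real.rpow_le_rpow_of_exponent_le one_le_two ?_
    have hsum' := hsum (n + 3)
    rw [Finset.sum_range_succ', add_zero] at hsum'
    rw [hsum', hsum]
    push_cast
    nlinarith
  obtain ⟨C, -, hC⟩ := Asymptotics.bound_of_isBigO_nat_atTop
    (f := fun n => qprod stagedSeq (n + 2) ^ s) (g'' := qprod digitChoices)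
    (Asymptotics.IsBigO.of_bound 1 (hev.mono fun n hn => by
      rwa [one_mul, Real.norm_of_nonneg (Real.rpow_nonneg (hq _).le _),
        Real.norm_of_nonneg (hc n).le]))
  refine ⟨C, fun n => ?_⟩
  have h2 := hC (x := n) (hc n).ne'
  rwa [Real.norm_of_nonneg (Real.rpow_nonneg (hq _).le _), Real.norm_of_nonneg (hc n).le] at h2

/-! ### Occurrences of blocks -/

/-- The digit sequence `e` carries the prescribed words, and its other digits are too large to
be letters of these words. -/
def FollowsWords (e : ℕ → ℕ) : Prop :=
  ∀ n, (slotOffset n < (slotWord n).length → e n = (slotWord n).getD (slotOffset n) 0) ∧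
    ((slotWord n).length ≤ slotOffset n → stageDepth (stageOf n) ≤ e n)

lemma length_slotWord_le (n : ℕ) : (slotWord n).length ≤ stageDepth (stageOf n) :=
  length_wordAt_le _ _

lemma slotOffset_lt (n : ℕ) : slotOffset n < (stageOf n).factorial :=
  Nat.mod_lt _ (Nat.factorial_pos _)

lemma slot_add {i j : ℕ} (h : slotOffset i + j < (stageOf i).factorial) :
    stageOf (i + j) = stageOf i ∧ slotOffset (i + j) = slotOffset i + j ∧
      slotWord (i + j) = slotWord i := by
  have h1 : i + j = (stageOf i).factorial * (i / (stageOf i).factorial) + (slotOffset i + j) := by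
    rw [← add_assoc, slotOffset, Nat.div_add_mod]
  have hdiv : (i + j) / (stageOf i).factorial = i / (stageOf i).factorial := by
    rw [h1, Nat.mul_add_div (Nat.factorial_pos _), Nat.div_eq_of_lt h, add_zero]
  have hmod : (i + j) % (stageOf i).factorial = slotOffset i + j := by
    rw [h1, Nat.mul_add_mod, Nat.mod_eq_of_lt h]
  have hst : stageOf (i + j) = stageOf i := by
    rw [stageOf_eq_iff, Finset.mem_Ico]
    refine ⟨(stageStart_stageOf_le i).trans (Nat.le_add_right _ _), ?_⟩
    have h2 := div_factorial_sub_lt i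
    have h3 : i / (stageOf i).factorial < stageOf i + (stageOf i ^ 2 + stageOf i + 1) := by omega
    rw [stageStart_succ, stageStart, ← add_mul, ← Nat.div_lt_iff_lt_mul (Nat.factorial_pos _),
      hdiv]
    exact h3
  refine ⟨hst, ?_, ?_⟩
  · rw [slotOffset, hst, hmod]
  · rw [slotWord, slotWord, hst, hdiv]

lemma FollowsWords.add_le_length {e : ℕ → ℕ} (he : FollowsWords e) {k : ℕ} {B : Fin k → ℕ}
    (hk : 1 ≤ k) {i : ℕ} (hB : ∀ j, B j < stageDepth (stageOf i))
    (h : ∀ j : Fin k, e (i + (j : ℕ)) = B j) : slotOffset i + k ≤ (slotWord i).length := by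
  by_contra! hlt
  have hj : (slotWord i).length - slotOffset i < k := by omega
  have hlen := length_slotWord_le i
  have hfac := stageDepth_lt_factorial (stageOf i)
  have hoff := slotOffset_lt i
  obtain ⟨h1, h2, h3⟩ := slot_add (i := i) (j := (slotWord i).length - slotOffset i) (by omega)
  have h4 := (he (i + ((slotWord i).length - slotOffset i))).2 (by rw [h2, h3]; omega)
  have h5 := hB ⟨_, hj⟩
  rw [← h ⟨_, hj⟩] at h5
  rw [h1] at h4
  exact absurd h5 (not_lt.2 h4)

lemma FollowsWords.slotWord_eq {e : ℕ → ℕ} (he : FollowsWords e) {k : ℕ} {B : Fin k → ℕ}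
    (hk : 1 ≤ k) {i : ℕ} (hB : ∀ j, B j < stageDepth (stageOf i))
    (h : ∀ j : Fin k, e (i + (j : ℕ)) = B j) (hlen : (slotWord i).length ≤ k) :
    slotOffset i = 0 ∧ slotWord i = List.ofFn B := by
  have h1 := he.add_le_length hk hB h
  have h0 : slotOffset i = 0 := by omega
  refine ⟨h0, List.ext_getElem (by simp; omega) fun j hj hj' => ?_⟩
  have hd := length_slotWord_le i
  have hfac := stageDepth_lt_factorial (stageOf i)
  obtain ⟨h2, h3, h4⟩ := slot_add (i := i) (j := j) (by omega)
  have h5 := (he (i + j)).1 (by rw [h3, h4]; omega)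
  rw [h3, h4, h0, zero_add, List.getD_eq_getElem _ _ hj] at h5
  rw [← h5, List.getElem_ofFn]
  exact h ⟨j, by omega⟩

lemma FollowsWords.occurs {e : ℕ → ℕ} (he : FollowsWords e) {k : ℕ} {B : Fin k → ℕ}
    {i : ℕ} (h0 : slotOffset i = 0) (hw : slotWord i = List.ofFn B)
    (j : Fin k) : e (i + (j : ℕ)) = B j := by
  have hlen : (slotWord i).length = k := by simp [hw]
  have hd := length_slotWord_le i
  have hfac := stageDepth_lt_factorial (stageOf i)
  have hj := j.2
  obtain ⟨h2, h3, h4⟩ := slot_add (i := i) (j := j) (by omega)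
  rw [(he (i + j)).1 (by rw [h3, h4]; omega), h3, h4, h0, zero_add,
    List.getD_eq_getElem _ _ (by omega)]
  simp [hw]

lemma card_filter_slotOffset_eq_zero (t : ℕ) (p : List ℕ → Prop) [DecidablePred p] :
    ((Finset.Ico (stageStart t) (stageStart (t + 1))).filter
      fun i => slotOffset i = 0 ∧ p (slotWord i)).card =
    ((Finset.range (t ^ 2 + t + 1)).filter fun s => p (wordAt (stageDepth t) s)).card := by
  have hf := Nat.factorial_pos t
  refine Finset.card_nbij' (fun i => i / t.factorial - t) (fun s => (t + s) * t.factorial)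
    ?_ ?_ ?_ ?_
  · intro i hi
    rw [Finset.mem_coe, Finset.mem_filter, ← stageOf_eq_iff] at hi
    obtain ⟨rfl, h0, hp⟩ := hi
    rw [Finset.mem_coe, Finset.mem_filter, Finset.mem_range]
    exact ⟨div_factorial_sub_lt i, hp⟩
  · intro s hs
    rw [Finset.mem_coe, Finset.mem_filter, Finset.mem_range] at hs
    have hst : stageOf ((t + s) * t.factorial) = t := by
      rw [stageOf_eq_iff, Finset.mem_Ico, stageStart_succ, stageStart, ← add_mul]
      exact ⟨Nat.mul_le_mul_right _ (Nat.le_add_right _ _), Nat.mul_lt_mul_of_pos_right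
        (Nat.add_lt_add_left hs.1 t) hf⟩
    rw [Finset.mem_coe, Finset.mem_filter, ← stageOf_eq_iff, slotOffset, slotWord, hst,
      Nat.mul_mod_left, Nat.mul_div_cancel _ hf, Nat.add_sub_cancel_left]
    exact ⟨rfl, rfl, hs.2⟩
  · intro i hi
    rw [Finset.mem_coe, Finset.mem_filter, ← stageOf_eq_iff] at hi
    obtain ⟨rfl, h0, hp⟩ := hi
    dsimp only
    rw [Nat.add_sub_cancel' (stageOf_le_div_factorial i)]
    exact Nat.div_mul_cancel (Nat.dvd_of_mod_eq_zero h0)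
  · intro s _
    dsimp only
    rw [Nat.mul_div_cancel _ hf, Nat.add_sub_cancel_left]

/-- The positions of stage `t` lying in a word of length greater than `k`. -/
noncomputable def longPositions (k t : ℕ) : Finset ℕ :=
  (Finset.Ico (stageStart t) (stageStart (t + 1))).filter
    fun i => k < (slotWord i).length ∧ slotOffset i < (slotWord i).length

lemma card_longPositions_le (k t : ℕ) : (longPositions k t).card ≤
    stageDepth t ^ (k + 3) * 2 ^ ((stageDepth t + 1) * (stageDepth t - (k + 1))) := by
  have h1 : (longPositions k t).card ≤
      (((Finset.range (t ^ 2 + t + 1)).filter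
        fun s => k < (wordAt (stageDepth t) s).length) ×ˢ Finset.range (stageDepth t)).card := by
    refine Finset.card_le_card_of_injOn (fun i => (i / t.factorial - t, i % t.factorial)) ?_ ?_
    · intro i hi
      rw [Finset.mem_coe, longPositions, Finset.mem_filter, ← stageOf_eq_iff] at hi
      obtain ⟨rfl, h1, h2⟩ := hi
      exact Finset.mem_coe.2 (Finset.mem_product.2 ⟨Finset.mem_filter.2
        ⟨Finset.mem_range.2 (div_factorial_sub_lt i), h1⟩,
        Finset.mem_range.2 (h2.trans_le (length_slotWord_le i))⟩)
    · intro i hi j hj hij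
      rw [Finset.mem_coe, longPositions, Finset.mem_filter, ← stageOf_eq_iff] at hi hj
      have h1 := stageOf_le_div_factorial i
      have h2 := stageOf_le_div_factorial j
      rw [hi.1] at h1
      rw [hj.1] at h2
      simp only [Prod.mk.injEq] at hij
      rw [← Nat.div_add_mod i t.factorial, ← Nat.div_add_mod j t.factorial, hij.2,
        (by omega : i / t.factorial = j / t.factorial)]
  rw [Finset.card_product, Finset.card_range, card_filter_wordAt (p := fun w => k < w.length)
    (by simp) (card_wordMultiset_stageDepth_le t)] at h1
  refine (h1.trans (Nat.mul_le_mul_right _ (countP_length_wordMultiset_le _ k))).trans_eq ?_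
  ring

lemma tendsto_card_longPositions_div (k : ℕ) :
    Tendsto (fun t => ((longPositions k t).card : ℝ) / stageWeight k t) atTop (𝓝 0) := by
  have h0 := (tendsto_pow_const_div_const_pow_of_one_lt (k + 3) (one_lt_two (α := ℝ))).comp
    tendsto_stageDepth
  refine squeeze_zero' (.of_forall fun t => div_nonneg (Nat.cast_nonneg _)
    (stageWeight_pos k t).le) ?_ h0
  filter_upwards [tendsto_stageDepth.eventually_ge_atTop (k + 1)] with t ht
  simp only [Function.comp]
  rw [stageWeight_eq (by omega), div_le_div_iff₀ (by positivity) (by positivity)]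
  have h1 := card_longPositions_le k t
  have h2 : (stageDepth t + 1) * (stageDepth t - k) =
      (stageDepth t + 1) * (stageDepth t - (k + 1)) + (stageDepth t + 1) := by
    rw [← Nat.mul_succ]
    congr 1
    omega
  rw [h2]
  norm_cast
  calc (longPositions k t).card * 2 ^ stageDepth t
      ≤ stageDepth t ^ (k + 3) * 2 ^ ((stageDepth t + 1) * (stageDepth t - (k + 1))) *
        2 ^ (stageDepth t + 1) :=
        Nat.mul_le_mul h1 (Nat.pow_le_pow_right two_pos (Nat.le_succ _))
    _ = _ := by ring

lemma FollowsWords.tendsto_card_div_refSum {e : ℕ → ℕ} (he : FollowsWords e) {k : ℕ}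
    (hk : 1 ≤ k) (B : Fin k → ℕ) {m r : ℕ} (hr : r < m) :
    Tendsto (fun n => (((Finset.range n).filter fun i =>
      i % m = r ∧ ∀ j : Fin k, e (i + (j : ℕ)) = B j).card : ℝ) / refSum k n) atTop
      (𝓝 (if r = 0 then 1 else 0)) := by
  set p : ℕ → Prop := fun i => i % m = r ∧ ∀ j : Fin k, e (i + (j : ℕ)) = B j with hp
  set c : ℝ := if r = 0 then 1 else 0 with hc
  have hcard : ∀ s : Finset ℕ, ((s.filter p).card : ℝ) = ∑ i ∈ s, if p i then (1 : ℝ) else 0 :=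
    fun s => Finset.natCast_card_filter _ _
  suffices H : Tendsto (fun n => (∑ i ∈ Finset.range n, if p i then (1 : ℝ) else 0) / refSum k n)
      atTop (𝓝 c) by
    refine H.congr fun n => ?_
    rw [← hcard]
  refine tendsto_sum_div_refSum (fun i => by split_ifs <;> norm_num) ?_
  simp only [← hcard]
  rw [tendsto_iff_norm_sub_tendsto_zero]
  refine squeeze_zero' (.of_forall fun t => norm_nonneg _) ?_ (tendsto_card_longPositions_div k)
  filter_upwards [eventually_ge_atTop m, tendsto_stageDepth.eventually_ge_atTop k,
    tendsto_stageDepth.eventually_gt_atTop (∑ j, B j)] with t htm htk htB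
  have hB : ∀ j, B j < stageDepth t := fun j =>
    (Finset.single_le_sum (fun _ _ => Nat.zero_le _) (Finset.mem_univ j)).trans_lt htB
  have hw := stageWeight_pos k t
  set I := Finset.Ico (stageStart t) (stageStart (t + 1)) with hI
  set A := I.filter fun i => slotOffset i = 0 ∧ slotWord i = List.ofFn B with hA
  have hAcard : (A.card : ℝ) = stageWeight k t := by
    have hnil : ¬ ([] : List ℕ) = List.ofFn B := fun h => by
      have := congrArg List.length h
      simp at this
      omega
    rw [hA, hI, card_filter_slotOffset_eq_zero t (fun w => w = List.ofFn B),
      card_filter_wordAt (p := fun w => w = List.ofFn B) hnil (card_wordMultiset_stageDepth_le t),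
      count_ofFn_wordMultiset hk htk hB, stageWeight_eq htk]
  have hmod : ∀ i ∈ A, i % m = 0 := by
    intro i hi
    rw [hA, Finset.mem_filter, hI, ← stageOf_eq_iff] at hi
    obtain ⟨rfl, h0, -⟩ := hi
    exact Nat.mod_eq_zero_of_dvd ((Nat.dvd_factorial (by omega) htm).trans
      (Nat.dvd_of_mod_eq_zero h0))
  have hsub : I.filter p ⊆ A ∪ longPositions k t := by
    intro i hi
    rw [Finset.mem_filter] at hi
    obtain ⟨hiI, -, hocc⟩ := hi
    have hst := stageOf_eq_iff.2 hiI
    rw [← hst] at hB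
    rw [Finset.mem_union, hA, longPositions, Finset.mem_filter, Finset.mem_filter]
    rcases le_or_gt (slotWord i).length k with h | h
    · exact Or.inl ⟨hiI, he.slotWord_eq hk hB hocc h⟩
    · have := he.add_le_length hk hB hocc
      exact Or.inr ⟨hiI, h, by omega⟩
  have hmain : |((I.filter p).card : ℝ) - c * stageWeight k t| ≤ (longPositions k t).card := by
    rcases eq_or_ne r 0 with h0 | h0
    · rw [hc, if_pos h0, one_mul, ← hAcard]
      have h1 : A ⊆ I.filter p := by
        intro i hi
        have h2 := hmod i hi
        rw [hA, Finset.mem_filter] at hi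
        exact Finset.mem_filter.2 ⟨hi.1, h2.trans h0.symm, he.occurs hi.2.1 hi.2.2⟩
      have h2 : (A.card : ℝ) ≤ (I.filter p).card := by exact_mod_cast Finset.card_le_card h1
      have h3 : ((I.filter p).card : ℝ) ≤ A.card + (longPositions k t).card := by
        exact_mod_cast (Finset.card_le_card hsub).trans (Finset.card_union_le _ _)
      rw [abs_le]
      constructor <;> linarith [(Nat.cast_nonneg (longPositions k t).card : (0 : ℝ) ≤ _)]
    · rw [hc, if_neg h0, zero_mul, sub_zero, abs_of_nonneg (Nat.cast_nonneg _)]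
      refine Nat.cast_le.2 (Finset.card_le_card fun i hi => ?_)
      refine (Finset.mem_union.1 (hsub hi)).resolve_left fun hiA => h0 ?_
      rw [← (Finset.mem_filter.1 hi).2.1, hmod i hiA]
  rw [Real.norm_eq_abs, ← mul_div_cancel_right₀ c hw.ne', ← sub_div, abs_div, abs_of_pos hw]
  exact div_le_div_of_nonneg_right hmain hw.le

/-! ### Normality and abnormality of the constructed numbers -/

lemma followsWords_add_qdigit (y : ℝ) :
    FollowsWords fun n => lowDigit n + qdigit digitChoices y n := by
  intro n
  refine ⟨fun h => ?_, fun h => ?_⟩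
  · have h1 : qdigit digitChoices y n < digitChoices n := qdigit_lt one_le_digitChoices y n
    rw [digitChoices, if_pos h, Nat.lt_one_iff] at h1
    simp only [h1, lowDigit, if_pos h, add_zero]
  · simp only [lowDigit, if_neg (not_lt.2 h)]
    exact Nat.le_add_right _ _

lemma add_qdigit_add_two_le_stagedSeq (y : ℝ) (n : ℕ) :
    lowDigit n + qdigit digitChoices y n + 2 ≤ stagedSeq n := by
  have h1 : qdigit digitChoices y n < digitChoices n := qdigit_lt one_le_digitChoices y n
  have h2 := lowDigit_add_digitChoices_le n
  omega

lemma eq_of_tendsto_div {a b c : ℕ → ℝ} {l l' : ℝ} (hl : l ≠ 0)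
    (hab : Tendsto (fun n => a n / b n) atTop (𝓝 1))
    (hbc : Tendsto (fun n => b n / c n) atTop (𝓝 l))
    (hac : Tendsto (fun n => a n / c n) atTop (𝓝 l')) : l = l' := by
  have h := hab.mul hbc
  rw [one_mul] at h
  refine tendsto_nhds_unique (h.congr' ?_) hac
  filter_upwards [hbc.eventually_ne hl] with n hn
  refine div_mul_div_cancel₀ fun hb => hn ?_
  rw [hb, zero_div]

lemma fullyDivergent_stagedSeq : FullyDivergent stagedSeq := by
  intro k hk
  have h := (tendsto_Qsum_div_refSum hk).pos_mul_atTop one_pos (tendsto_refSum k)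
  refine h.congr' ?_
  filter_upwards [(tendsto_refSum k).eventually_gt_atTop 0] with n hn
  exact div_mul_cancel₀ _ hn.ne'

lemma qNormal_of_followsWords {x : ℝ} (he : FollowsWords (qdigit stagedSeq x)) :
    QNormal stagedSeq x := by
  intro k hk B
  have h1 := he.tendsto_card_div_refSum hk B zero_lt_one
  have h2 := h1.div (tendsto_Qsum_div_refSum hk) one_ne_zero
  simp only [if_true, div_one] at h2
  refine h2.congr' ?_
  filter_upwards [(tendsto_refSum k).eventually_gt_atTop 0] with n hn
  simp only [Pi.div_apply, Nat.mod_one, true_and]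
  exact div_div_div_cancel_right₀ hn.ne' _ _

lemma apAbnormalI_of_followsWords {x : ℝ} (he : FollowsWords (qdigit stagedSeq x)) :
    APAbnormalI stagedSeq x := by
  intro m hm r hr h
  have hm' : (2 : ℝ) ≤ m := by exact_mod_cast hm
  have h1 := eq_of_tendsto_div (by positivity) (h 0) (tendsto_apQsum_div_refSum hr)
    (he.tendsto_card_div_refSum (by omega) 0 hr)
  split_ifs at h1
  · rw [div_eq_iff (by positivity)] at h1
    linarith
  · have : 0 < 1 / (m : ℝ) := by positivity
    linarith

lemma blockCount_lamQ_two_one {q e : ℕ → ℕ} (h : ∀ n, e n + 2 ≤ q n) (n : ℕ) :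
    blockCount (lamQ q 2 1) (Ups q 2 1 (cantorValue q e)) (0 : Fin 1 → ℕ) n =
      ((Finset.range (2 * n)).filter fun i =>
        i % 2 = 1 ∧ ∀ j : Fin 1, e (i + (j : ℕ)) = (0 : Fin 1 → ℕ) j).card := by
  have hU : Ups q 2 1 (cantorValue q e) = cantorValue (lamQ q 2 1) fun t => e (2 * t + 1) := by
    have : (fun t => e (2 * t + 1)) = fun t => qdigit q (cantorValue q e) (2 * t + 1) :=
      funext fun t => (qdigit_cantorValue h _).symm
    rw [this]
    rfl
  have hd := qdigit_cantorValue (q := lamQ q 2 1) (e := fun t => e (2 * t + 1)) fun t => h _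
  rw [blockCount, hU]
  refine Finset.card_nbij' (fun t => 2 * t + 1) (fun i => i / 2) ?_ ?_ ?_ ?_
  · intro t ht
    simp only [hd, Finset.coe_filter, Set.mem_ofPred_eq, Finset.mem_range, Fin.forall_fin_one,
      Fin.val_zero, add_zero] at ht ⊢
    exact ⟨by omega, by omega, ht.2⟩
  · intro i hi
    simp only [hd, Finset.coe_filter, Set.mem_ofPred_eq, Finset.mem_range, Fin.forall_fin_one,
      Fin.val_zero, add_zero] at hi ⊢
    refine ⟨by omega, ?_⟩
    rw [(by omega : 2 * (i / 2) + 1 = i)]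
    exact hi.2.2
  · intro t _
    dsimp only
    omega
  · intro i hi
    have := (Finset.mem_filter.1 (Finset.mem_coe.1 hi)).2.1
    dsimp only
    omega

lemma not_apNormalII_cantorValue {e : ℕ → ℕ} (h : ∀ n, e n + 2 ≤ stagedSeq n)
    (he : FollowsWords e) : ¬ APNormalII stagedSeq (cantorValue stagedSeq e) := by
  intro hn
  have h2 : Tendsto (fun n : ℕ => 2 * n) atTop atTop :=
    tendsto_id.const_mul_atTop' two_pos
  have h3 := (tendsto_sum_blockWeight_div_refSum (k := 1) le_rfl one_lt_two).comp h2
  have h4 := (he.tendsto_card_div_refSum le_rfl (0 : Fin 1 → ℕ) one_lt_two).comp h2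
  have h1 := hn 1 le_rfl 2 one_le_two 1 one_lt_two 0
  simp only [blockCount_lamQ_two_one h, Qsum_lamQ_two_one] at h1
  have := eq_of_tendsto_div (by norm_num) h1 h3 h4
  norm_num at this

/-- There is a fully divergent, infinite in limit basic sequence `Q` with
`dim_H(N(Q) ∩ N^{I}_{Ab}(Q) \ N^{II}(Q)) = 1`. -/
theorem stmt3 :
    ∃ Q : ℕ → ℕ, IsBasic Q ∧ FullyDivergent Q ∧ InfiniteInLimit Q ∧
      dimH (({x : ℝ | QNormal Q x} ∩ {x : ℝ | APAbnormalI Q x}) \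
        {x : ℝ | APNormalII Q x}) = 1 := by
  refine ⟨stagedSeq, two_le_stagedSeq, fullyDivergent_stagedSeq, tendsto_stagedSeq,
    le_antisymm ?_ ?_⟩
  · exact (dimH_mono (Set.subset_univ _)).trans_eq Real.dimH_univ
  · refine one_le_dimH_of_cantorValue_mem one_le_digitChoices lowDigit_add_digitChoices_le
      (fun s => exists_qprod_stagedSeq_rpow_le) fun y _ => ?_
    have hq := add_qdigit_add_two_le_stagedSeq y
    have he := followsWords_add_qdigit y
    have he' : FollowsWords (qdigit stagedSeq
        (cantorValue stagedSeq fun n => lowDigit n + qdigit digitChoices y n)) := by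
      rwa [funext (qdigit_cantorValue hq)]
    exact ⟨⟨qNormal_of_followsWords he', apAbnormalI_of_followsWords he'⟩,
      not_apNormalII_cantorValue hq he⟩
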